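/- arXiv:2204.03300 — 9 statements merged into one kernel-verified Lean document; each statement's English description precedes it below -/
import Mathlib

section
/- Let ρ>0, r>0, and let g ∈ C_{ρ/2}([0,∞);ℝ). Define h(t) := (1/(4r)) ∫_t^∞ e^{−ρ(s−t)} g(s)² ds for t ≥ 0. Then h is well-defined, continuously differentiable, satisfies h′(t) = ρ h(t) − g(t)²/(4r) for all t ≥ 0, belongs to C_ρ([0,∞);ℝ), and h is the unique solution of this ODE in C_ρ([0,∞);ℝ) ∩ C¹([0,∞);ℝ). -/
open MeasureTheory Set Filter Topology

/-- A function of exponential order below `ρ` vanishes at infinity once damped by `e^{-ρt}`. -/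
theorem tendsto_exp_neg_mul_of_exp_order {ρ ρ' M : ℝ} {f : ℝ → ℝ} (hlt : ρ' < ρ)
    (hf : ∀ t ≥ (0 : ℝ), Real.exp (-(ρ' * t)) * |f t| ≤ M) :
    Tendsto (fun t => Real.exp (-(ρ * t)) * f t) atTop (𝓝 0) := by
  have hlim : Tendsto (fun t : ℝ => Real.exp (-((ρ - ρ') * t)) * M) atTop (𝓝 0) := by
    have h1 : Tendsto (fun t : ℝ => (ρ - ρ') * t) atTop atTop :=
      tendsto_id.const_mul_atTop (sub_pos.2 hlt)
    simpa using (Real.tendsto_exp_neg_atTop_nhds_zero.comp h1).mul_const M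
  refine squeeze_zero_norm' ?_ hlim
  filter_upwards [eventually_ge_atTop (0 : ℝ)] with t ht
  have hsplit : Real.exp (-(ρ * t)) = Real.exp (-((ρ - ρ') * t)) * Real.exp (-(ρ' * t)) := by
    rw [← Real.exp_add]; ring_nf
  rw [Real.norm_eq_abs, abs_mul, Real.abs_exp, hsplit, mul_assoc]
  exact mul_le_mul_of_nonneg_left (hf t ht) (Real.exp_pos _).le

/-- Two solutions of `u' = ρ u - c` on `[0,∞)` that vanish at infinity once damped by `e^{-ρt}`
agree. -/
theorem eqOn_of_hasDerivWithinAt_linear {ρ : ℝ} {c u v : ℝ → ℝ}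
    (hu : ∀ t ≥ (0 : ℝ), HasDerivWithinAt u (ρ * u t - c t) (Ici 0) t)
    (hv : ∀ t ≥ (0 : ℝ), HasDerivWithinAt v (ρ * v t - c t) (Ici 0) t)
    (hu0 : Tendsto (fun t => Real.exp (-(ρ * t)) * u t) atTop (𝓝 0))
    (hv0 : Tendsto (fun t => Real.exp (-(ρ * t)) * v t) atTop (𝓝 0)) :
    EqOn u v (Ici 0) := by
  let d : ℝ → ℝ := fun t => Real.exp (-(ρ * t)) * (u t - v t)
  have hd : ∀ t ≥ (0 : ℝ), HasDerivWithinAt d 0 (Ici 0) t := by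
    intro t ht
    have he : HasDerivAt (fun t : ℝ => Real.exp (-(ρ * t))) (Real.exp (-(ρ * t)) * -(ρ * 1)) t :=
      ((hasDerivAt_id t).const_mul ρ).neg.exp
    refine (he.hasDerivWithinAt.mul ((hu t ht).sub (hv t ht))).congr_deriv ?_
    simp only [Pi.sub_apply]
    ring
  have hconst : ∀ b ≥ (0 : ℝ), d b = d 0 := fun b hb =>
    constant_of_has_deriv_right_zero (a := 0) (b := b)
      (fun x hx => (hd x hx.1).continuousWithinAt.mono Icc_subset_Ici_self)
      (fun x hx => (hd x hx.1).mono (Ici_subset_Ici.2 hx.1)) b ⟨hb, le_rfl⟩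
  have hlim : Tendsto d atTop (𝓝 0) := by
    simpa [d, mul_sub] using hu0.sub hv0
  have hd0 : d 0 = 0 := by
    refine tendsto_nhds_unique (tendsto_const_nhds.congr' ?_) hlim
    filter_upwards [eventually_ge_atTop (0 : ℝ)] with t ht using (hconst t ht).symm
  intro t ht
  have h1 : Real.exp (-(ρ * t)) * (u t - v t) = 0 := (hconst t ht).trans hd0
  exact sub_eq_zero.1 ((mul_eq_zero.1 h1).resolve_left (Real.exp_ne_zero _))

/-- The square of a function of exponential order at most `ρ'/2` has exponential order `ρ'`. -/
theorem exp_neg_mul_sq_le {ρ ρ' M x s : ℝ} (h : Real.exp (-(ρ' * s) / 2) * |x| ≤ M) :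
    Real.exp (-(ρ * s)) * x ^ 2 ≤ M ^ 2 * Real.exp (-(ρ - ρ') * s) := by
  have h1 : (Real.exp (-(ρ' * s) / 2) * |x|) ^ 2 ≤ M ^ 2 :=
    pow_le_pow_left₀ (by positivity) h 2
  have h2 : Real.exp (-(ρ * s)) * x ^ 2 =
      (Real.exp (-(ρ' * s) / 2) * |x|) ^ 2 * Real.exp (-(ρ - ρ') * s) := by
    rw [mul_pow, sq_abs, ← Real.exp_nat_mul, mul_right_comm, ← Real.exp_add]
    push_cast
    ring_nf
  rw [h2]
  exact mul_le_mul_of_nonneg_right h1 (Real.exp_pos _).le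

/-- For `g ∈ C_{ρ/2}([0,∞);ℝ)`, the function
`h t = (1/(4r)) ∫_t^∞ e^{-ρ(s-t)} g(s)² ds` is well-defined, C¹, satisfies
`h' = ρ h − g²/(4r)` on `[0,∞)`, belongs to `C_ρ([0,∞);ℝ)`, and is the unique
solution of this ODE in `C_ρ([0,∞);ℝ) ∩ C¹([0,∞);ℝ)`. -/
theorem stmt_4 (ρ r : ℝ) (hρ : 0 < ρ) (hr : 0 < r)
    (g : ℝ → ℝ) (hgc : ContinuousOn g (Ici 0))
    (hg : ∃ ρ' ∈ Ico (0 : ℝ) ρ, ∃ M : ℝ, ∀ t ≥ (0 : ℝ),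
      Real.exp (-(ρ' * t) / 2) * |g t| ≤ M)
    (h : ℝ → ℝ)
    (hh : ∀ t, h t = (1 / (4 * r)) * ∫ s in Ioi t, Real.exp (-ρ * (s - t)) * (g s) ^ 2) :
    (∀ t ≥ (0 : ℝ),
      IntegrableOn (fun s => Real.exp (-ρ * (s - t)) * (g s) ^ 2) (Ioi t)) ∧
    ContDiffOn ℝ 1 h (Ici 0) ∧
    (∀ t ≥ (0 : ℝ),
      HasDerivWithinAt h (ρ * h t - (g t) ^ 2 / (4 * r)) (Ici 0) t) ∧
    (ContinuousOn h (Ici 0) ∧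
      ∃ ρ' ∈ Ico (0 : ℝ) ρ, ∃ M : ℝ, ∀ t ≥ (0 : ℝ),
        Real.exp (-(ρ' * t)) * |h t| ≤ M) ∧
    ∀ htil : ℝ → ℝ,
      ContDiffOn ℝ 1 htil (Ici 0) → ContinuousOn htil (Ici 0) →
      (∃ ρ' ∈ Ico (0 : ℝ) ρ, ∃ M : ℝ, ∀ t ≥ (0 : ℝ),
        Real.exp (-(ρ' * t)) * |htil t| ≤ M) →
      (∀ t ≥ (0 : ℝ),
        HasDerivWithinAt htil (ρ * htil t - (g t) ^ 2 / (4 * r)) (Ici 0) t) →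
      EqOn htil h (Ici 0) := by
  obtain ⟨ρ', hρ', M, hM⟩ := hg
  have hδ : 0 < ρ - ρ' := sub_pos.2 hρ'.2
  let G : ℝ → ℝ := fun s => g (max s 0)
  have hG : Continuous G := hgc.comp_continuous (by fun_prop) fun s => le_max_right s 0
  -- `G` extends `g` continuously to the line; the damped integrand is then continuous everywhere.
  have hGg : ∀ s ≥ (0 : ℝ), G s = g s := fun s hs => by simp only [G, max_eq_left hs]
  let F : ℝ → ℝ := fun s => Real.exp (-(ρ * s)) * G s ^ 2
  have hF : Continuous F := by fun_prop
  have hF0 : ∀ s, 0 ≤ F s := fun s => by positivity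
  have hFle : ∀ s ≥ (0 : ℝ), F s ≤ M ^ 2 * Real.exp (-(ρ - ρ') * s) := fun s hs => by
    simp only [F, hGg s hs]
    exact exp_neg_mul_sq_le (hM s hs)
  have hexpint : ∀ t, IntegrableOn (fun s => M ^ 2 * Real.exp (-(ρ - ρ') * s)) (Ioi t) :=
    fun t => (integrableOn_exp_mul_Ioi (neg_lt_zero.2 hδ) t).const_mul _
  have hFint : ∀ t ≥ (0 : ℝ), IntegrableOn F (Ioi t) := fun t ht => by
    refine (hexpint t).mono' hF.aestronglyMeasurable ?_
    filter_upwards [ae_restrict_mem measurableSet_Ioi] with s hs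
    rw [Real.norm_eq_abs, abs_of_nonneg (hF0 s)]
    exact hFle s (ht.le.trans (le_of_lt hs))
  have hfac : ∀ t ≥ (0 : ℝ), EqOn (fun s => Real.exp (-ρ * (s - t)) * (g s) ^ 2)
      (fun s => Real.exp (ρ * t) * F s) (Ioi t) := fun t ht s hs => by
    simp only [F, hGg s (ht.le.trans (le_of_lt hs)), ← mul_assoc, ← Real.exp_add]
    ring_nf
  have hhF : ∀ t ≥ (0 : ℝ), h t = 1 / (4 * r) * (Real.exp (ρ * t) * ∫ s in Ioi t, F s) :=
    fun t ht => by
      rw [hh, setIntegral_congr_fun measurableSet_Ioi (hfac t ht), integral_const_mul]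
  let H : ℝ → ℝ := fun t =>
    1 / (4 * r) * (Real.exp (ρ * t) * ((∫ s in Ioi 0, F s) - ∫ s in (0 : ℝ)..t, F s))
  have hhH : ∀ t ≥ (0 : ℝ), h t = H t := fun t ht => by
    have := intervalIntegral.integral_interval_add_Ioi (hFint 0 le_rfl) (hFint t ht)
    rw [hhF t ht, eq_sub_of_add_eq' this]
  have hH : ∀ t, HasDerivAt H (ρ * H t - G t ^ 2 / (4 * r)) t := fun t => by
    have he : HasDerivAt (fun t : ℝ => Real.exp (ρ * t)) (Real.exp (ρ * t) * (ρ * 1)) t :=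
      ((hasDerivAt_id t).const_mul ρ).exp
    have hI : HasDerivAt (fun t => (∫ s in Ioi 0, F s) - ∫ s in (0 : ℝ)..t, F s) (-F t) t :=
      (hF.integral_hasStrictDerivAt 0 t).hasDerivAt.const_sub _
    refine ((he.mul hI).const_mul (1 / (4 * r))).congr_deriv ?_
    have hone : Real.exp (ρ * t) * F t = G t ^ 2 := by
      simp only [F, ← mul_assoc, ← Real.exp_add, add_neg_cancel, Real.exp_zero, one_mul]
    rw [mul_neg, hone]
    simp only [H]
    ring
  have hHdiff : ContDiff ℝ 1 H := by
    have hHc : Continuous H := continuous_iff_continuousAt.2 fun t => (hH t).continuousAt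
    refine contDiff_one_iff_deriv.2 ⟨fun t => (hH t).differentiableAt, ?_⟩
    rw [show deriv H = fun t => ρ * H t - G t ^ 2 / (4 * r) from funext fun t => (hH t).deriv]
    fun_prop
  have hhdiff : ContDiffOn ℝ 1 h (Ici 0) := hHdiff.contDiffOn.congr hhH
  have hhode : ∀ t ≥ (0 : ℝ),
      HasDerivWithinAt h (ρ * h t - (g t) ^ 2 / (4 * r)) (Ici 0) t := fun t ht => by
    rw [hhH t ht, ← hGg t ht]
    exact (hH t).hasDerivWithinAt.congr hhH (hhH t ht)
  have hhbound : ∀ t ≥ (0 : ℝ),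
      Real.exp (-(ρ' * t)) * |h t| ≤ 1 / (4 * r) * (M ^ 2 / (ρ - ρ')) := fun t ht => by
    have hI0 : 0 ≤ ∫ s in Ioi t, F s := integral_nonneg hF0
    have hI : ∫ s in Ioi t, F s ≤ M ^ 2 * (Real.exp (-(ρ - ρ') * t) / (ρ - ρ')) := by
      refine (setIntegral_mono_on (hFint t ht) (hexpint t) measurableSet_Ioi
        fun s hs => hFle s (ht.le.trans (le_of_lt hs))).trans_eq ?_
      rw [integral_const_mul, integral_exp_mul_Ioi (neg_lt_zero.2 hδ), neg_div_neg_eq]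
    have hE : Real.exp (-(ρ' * t)) * Real.exp (ρ * t) * Real.exp (-(ρ - ρ') * t) = 1 := by
      rw [← Real.exp_add, ← Real.exp_add, Real.exp_eq_one_iff]
      ring
    rw [hhF t ht, abs_of_nonneg (by positivity)]
    calc Real.exp (-(ρ' * t)) * (1 / (4 * r) * (Real.exp (ρ * t) * ∫ s in Ioi t, F s))
        ≤ Real.exp (-(ρ' * t)) * (1 / (4 * r) * (Real.exp (ρ * t) *
            (M ^ 2 * (Real.exp (-(ρ - ρ') * t) / (ρ - ρ'))))) := by gcongr
      _ = 1 / (4 * r) * (M ^ 2 / (ρ - ρ')) *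
            (Real.exp (-(ρ' * t)) * Real.exp (ρ * t) * Real.exp (-(ρ - ρ') * t)) := by ring
      _ = 1 / (4 * r) * (M ^ 2 / (ρ - ρ')) := by rw [hE, mul_one]
  refine ⟨fun t ht =>
      IntegrableOn.congr_fun ((hFint t ht).const_mul _) (hfac t ht).symm measurableSet_Ioi,
    hhdiff, hhode, ⟨hhdiff.continuousOn, ρ', hρ', _, hhbound⟩, ?_⟩
  rintro htil - - ⟨ρ₁, hρ₁, M₁, hM₁⟩ hode
  exact eqOn_of_hasDerivWithinAt_linear hode hhode
    (tendsto_exp_neg_mul_of_exp_order hρ₁.2 hM₁) (tendsto_exp_neg_mul_of_exp_order hρ'.2 hhbound)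
end

section
/- Let ρ>0, μ>0, α>0, β>0, λ>0, γ>0, r>0, c ∈ (0,1), x₀ ∈ ℝ, p₀ ∈ ℝ. Given m^X ∈ C_{ρ/2}([0,∞);ℝ), let m^P be the C¹ solution of (m^P)′(t) = α(β − (1−λγ) m^X(t) − m^P(t)), m^P(0) = p₀. Then the function L(m^X) defined by [L(m^X)](t) := e^{−μt} x₀ + ((1−c)/(2r)) ∫_0^t e^{−μ(t−s)} ( ∫_s^∞ e^{−(μ+ρ)(v−s)} m^P(v) dv ) ds is well-defined and belongs to C_{ρ/2}([0,∞);ℝ). -/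
open MeasureTheory Set

/-- Exponential growth bound for solutions of the damped linear equation `f' = g - a f`
whose forcing grows at most like `exp (δ t)`. -/
theorem abs_le_mul_exp_of_hasDerivWithinAt_sub_mul {f g : ℝ → ℝ} {a δ G : ℝ}
    (haδ : 0 < a + δ)
    (hf : ∀ t ≥ (0 : ℝ), HasDerivWithinAt f (g t - a * f t) (Ici 0) t)
    (hg : ∀ t ≥ (0 : ℝ), |g t| ≤ G * Real.exp (δ * t)) {t : ℝ} (ht : 0 ≤ t) :
    |f t| ≤ (|f 0| + G / (a + δ)) * Real.exp (δ * t) := by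
  have hG : 0 ≤ G := by simpa using (abs_nonneg _).trans (hg 0 le_rfl)
  have hF : ∀ t ≥ (0 : ℝ), HasDerivWithinAt (fun t => Real.exp (a * t) * f t)
      (Real.exp (a * t) * g t) (Ici 0) t := fun t ht => by
    have he : HasDerivWithinAt (fun t => Real.exp (a * t)) (Real.exp (a * t) * a) (Ici 0) t := by
      simpa using (((hasDerivAt_id t).const_mul a).exp).hasDerivWithinAt
    exact (he.mul (hf t ht)).congr_deriv (by ring)
  have hB : ∀ t, HasDerivAt (fun t => |f 0| + G / (a + δ) * (Real.exp ((a + δ) * t)))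
      (G * Real.exp ((a + δ) * t)) t := fun t => by
    have he : HasDerivAt (fun t => Real.exp ((a + δ) * t))
        (Real.exp ((a + δ) * t) * (a + δ)) t := by
      simpa using ((hasDerivAt_id t).const_mul (a + δ)).exp
    exact ((he.const_mul (G / (a + δ))).const_add |f 0|).congr_deriv (by field_simp)
  have key := image_norm_le_of_norm_deriv_right_le_deriv_boundary (a := 0) (b := t)
    (fun x hx => ((hF x hx.1).mono Icc_subset_Ici_self).continuousWithinAt)
    (fun x hx => (hF x hx.1).mono (Ici_subset_Ici.2 hx.1))
    (by simpa using div_nonneg hG haδ.le) hB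
    (fun x hx => by
      rw [Real.norm_eq_abs, abs_mul, Real.abs_exp, add_mul, Real.exp_add]
      nlinarith [mul_le_mul_of_nonneg_left (hg x hx.1) (Real.exp_pos (a * x)).le])
    (right_mem_Icc.2 ht)
  rw [Real.norm_eq_abs, abs_mul, Real.abs_exp] at key
  have hexp : 1 ≤ Real.exp ((a + δ) * t) := Real.one_le_exp (by positivity)
  refine le_of_mul_le_mul_left (key.trans ?_) (Real.exp_pos (a * t))
  calc _ ≤ (|f 0| + G / (a + δ)) * Real.exp ((a + δ) * t) := by
        nlinarith [mul_le_mul_of_nonneg_left hexp (abs_nonneg (f 0))]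
    _ = _ := by rw [add_mul a δ t, Real.exp_add]; ring

section DiscountedTail

variable {q : ℝ → ℝ} {k δ K s : ℝ}

theorem abs_exp_mul_le_of_abs_le {v : ℝ} (hv : |q v| ≤ K * Real.exp (δ * v)) :
    |Real.exp (-k * (v - s)) * q v| ≤ K * Real.exp (k * s) * Real.exp (-(k - δ) * v) := by
  rw [abs_mul, Real.abs_exp]
  calc _ ≤ Real.exp (-k * (v - s)) * (K * Real.exp (δ * v)) := by gcongr
    _ = K * Real.exp (-k * (v - s) + δ * v) := by rw [Real.exp_add]; ring
    _ = _ := by rw [mul_assoc, ← Real.exp_add]; ring_nf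

theorem integrableOn_Ioi_exp_mul (hkδ : δ < k) (hq : ContinuousOn q (Ici 0))
    (hqK : ∀ t ≥ (0 : ℝ), |q t| ≤ K * Real.exp (δ * t)) (hs : 0 ≤ s) :
    IntegrableOn (fun v => Real.exp (-k * (v - s)) * q v) (Ioi s) := by
  refine Integrable.mono' ((integrableOn_exp_mul_Ioi (a := -(k - δ)) (by linarith) s).const_mul
    (K * Real.exp (k * s))) ?_ ?_
  · refine ContinuousOn.aestronglyMeasurable ?_ measurableSet_Ioi
    exact ContinuousOn.mul (by fun_prop) (hq.mono fun v hv => hs.trans (le_of_lt hv))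
  · filter_upwards [ae_restrict_mem measurableSet_Ioi] with v hv
    exact abs_exp_mul_le_of_abs_le (hqK v (hs.trans (le_of_lt hv)))

theorem abs_integral_Ioi_exp_mul_le (hkδ : δ < k)
    (hqK : ∀ t ≥ (0 : ℝ), |q t| ≤ K * Real.exp (δ * t)) (hs : 0 ≤ s) :
    |∫ v in Ioi s, Real.exp (-k * (v - s)) * q v| ≤ K / (k - δ) * Real.exp (δ * s) := by
  have hneg : -(k - δ) < 0 := by linarith
  rw [← Real.norm_eq_abs]
  calc ‖∫ v in Ioi s, Real.exp (-k * (v - s)) * q v‖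
    _ ≤ ∫ v in Ioi s, K * Real.exp (k * s) * Real.exp (-(k - δ) * v) := by
        refine norm_integral_le_of_norm_le ((integrableOn_exp_mul_Ioi hneg s).const_mul _) ?_
        filter_upwards [ae_restrict_mem measurableSet_Ioi] with v hv
        exact abs_exp_mul_le_of_abs_le (hqK v (hs.trans (le_of_lt hv)))
    _ = K / (k - δ) * (Real.exp (k * s) * Real.exp (-(k - δ) * s)) := by
        rw [integral_const_mul, integral_exp_mul_Ioi hneg, neg_div_neg_eq]; ring
    _ = _ := by rw [← Real.exp_add]; ring_nf

theorem continuousOn_integral_Ioi_exp_mul (hkδ : δ < k) (hq : ContinuousOn q (Ici 0))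
    (hqK : ∀ t ≥ (0 : ℝ), |q t| ≤ K * Real.exp (δ * t)) :
    ContinuousOn (fun s => ∫ v in Ioi s, Real.exp (-k * (v - s)) * q v) (Ici 0) := by
  have hint : IntegrableOn (fun v => Real.exp (-k * v) * q v) (Ioi 0) := by
    simpa using integrableOn_Ioi_exp_mul hkδ hq hqK le_rfl
  have hq' : Continuous fun v => q (max v 0) :=
    hq.comp_continuous (by fun_prop) fun v => mem_Ici.2 (le_max_right v 0)
  have hcont : Continuous fun s => Real.exp (k * s) * ((∫ v in Ioi 0, Real.exp (-k * v) * q v) -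
      ∫ v in (0 : ℝ)..s, Real.exp (-k * v) * q (max v 0)) :=
    Continuous.mul (by fun_prop) <| continuous_const.sub <|
      intervalIntegral.continuous_primitive
        (fun a b => (Continuous.mul (by fun_prop) hq').intervalIntegrable a b) 0
  refine hcont.continuousOn.congr fun s (hs : 0 ≤ s) => ?_
  have hfac : ∀ v, Real.exp (-k * (v - s)) * q v =
      Real.exp (k * s) * (Real.exp (-k * v) * q v) := fun v => by
    rw [← mul_assoc, ← Real.exp_add]; ring_nf
  have hext : ∫ v in (0 : ℝ)..s, Real.exp (-k * v) * q (max v 0) =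
      ∫ v in (0 : ℝ)..s, Real.exp (-k * v) * q v :=
    intervalIntegral.integral_congr fun v hv => by
      rw [uIcc_of_le hs] at hv
      simp [max_eq_left hv.1]
  simp only [hfac, integral_const_mul, hext]
  rw [← intervalIntegral.integral_Ioi_sub_Ioi hint hs, sub_sub_cancel]

end DiscountedTail

/-- The variation-of-constants formula solves `f' = h - a f`. -/
theorem hasDerivWithinAt_variation_of_constants {h : ℝ → ℝ} (hh : ContinuousOn h (Ici 0))
    (a x₀ C : ℝ) {t : ℝ} (ht : 0 ≤ t) :
    HasDerivWithinAt
      (fun t => Real.exp (-a * t) * x₀ + C * ∫ s in (0 : ℝ)..t, Real.exp (-a * (t - s)) * h s)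
      (C * h t - a * (Real.exp (-a * t) * x₀ +
        C * ∫ s in (0 : ℝ)..t, Real.exp (-a * (t - s)) * h s)) (Ici 0) t := by
  have hh' : Continuous fun v => h (max v 0) :=
    hh.comp_continuous (by fun_prop) fun v => mem_Ici.2 (le_max_right v 0)
  have hrep : ∀ t ≥ (0 : ℝ), ∫ s in (0 : ℝ)..t, Real.exp (-a * (t - s)) * h s =
      Real.exp (-a * t) * ∫ s in (0 : ℝ)..t, Real.exp (a * s) * h (max s 0) := fun t ht => by
    rw [← intervalIntegral.integral_const_mul]
    refine intervalIntegral.integral_congr fun s hs => ?_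
    rw [uIcc_of_le ht] at hs
    simp only [max_eq_left hs.1]
    rw [← mul_assoc, ← Real.exp_add]; ring_nf
  have hprim : HasDerivAt (fun t => ∫ s in (0 : ℝ)..t, Real.exp (a * s) * h (max s 0))
      (Real.exp (a * t) * h (max t 0)) t :=
    ((Continuous.mul (by fun_prop) hh').integral_hasStrictDerivAt 0 t).hasDerivAt
  have hexp : HasDerivAt (fun t => Real.exp (-a * t)) (Real.exp (-a * t) * -a) t := by
    simpa using ((hasDerivAt_id t).const_mul (-a)).exp
  have hsum := (hexp.mul_const x₀).add ((hexp.mul hprim).const_mul C)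
  refine (hsum.hasDerivWithinAt.congr (fun t ht => ?_) ?_).congr_deriv ?_
  · simp only [hrep t ht, Pi.add_apply, Pi.mul_apply]
  · simp only [hrep t ht, Pi.add_apply, Pi.mul_apply]
  · have hinv : Real.exp (-a * t) * Real.exp (a * t) = 1 := by rw [← Real.exp_add]; simp
    rw [hrep t ht, max_eq_left ht]
    linear_combination C * h t * hinv

/-- Given `mX ∈ C_{ρ/2}([0,∞);ℝ)` and the C¹ solution `mP` of
`mP' = α(β − (1−λγ) mX − mP)`, `mP 0 = p₀`, the map
`L t = e^{−μt} x₀ + ((1−c)/(2r)) ∫_0^t e^{−μ(t−s)} (∫_s^∞ e^{−(μ+ρ)(v−s)} mP(v) dv) ds`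
is well-defined and belongs to `C_{ρ/2}([0,∞);ℝ)`. -/
theorem stmt_5 (ρ μ α β lam γ r c x₀ p₀ : ℝ)
    (hρ : 0 < ρ) (hμ : 0 < μ) (hα : 0 < α) (hβ : 0 < β) (hlam : 0 < lam) (hγ : 0 < γ)
    (hr : 0 < r) (hc : c ∈ Ioo (0 : ℝ) 1)
    (mX mP : ℝ → ℝ)
    (hmXc : ContinuousOn mX (Ici 0))
    (hmX : ∃ ρ' ∈ Ico (0 : ℝ) ρ, ∃ M : ℝ, ∀ t ≥ (0 : ℝ),
      Real.exp (-(ρ' * t) / 2) * |mX t| ≤ M)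
    (hmPC1 : ContDiffOn ℝ 1 mP (Ici 0))
    (hODE : ∀ t ≥ (0 : ℝ),
      HasDerivWithinAt mP (α * (β - (1 - lam * γ) * mX t - mP t)) (Ici 0) t)
    (hP0 : mP 0 = p₀)
    (L : ℝ → ℝ)
    (hL : ∀ t, L t = Real.exp (-μ * t) * x₀ +
      ((1 - c) / (2 * r)) * ∫ s in (0 : ℝ)..t, Real.exp (-μ * (t - s)) *
        ∫ v in Ioi s, Real.exp (-(μ + ρ) * (v - s)) * mP v) :
    (∀ s ≥ (0 : ℝ),
      IntegrableOn (fun v => Real.exp (-(μ + ρ) * (v - s)) * mP v) (Ioi s)) ∧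
    (∀ t ≥ (0 : ℝ),
      IntervalIntegrable (fun s => Real.exp (-μ * (t - s)) *
        ∫ v in Ioi s, Real.exp (-(μ + ρ) * (v - s)) * mP v) volume 0 t) ∧
    ContinuousOn L (Ici 0) ∧
    ∃ ρ' ∈ Ico (0 : ℝ) ρ, ∃ M : ℝ, ∀ t ≥ (0 : ℝ),
      Real.exp (-(ρ' * t) / 2) * |L t| ≤ M := by
  obtain ⟨ρ', ⟨hρ'0, hρ'⟩, M, hM⟩ := hmX
  have hdiv : ∀ t : ℝ, -(ρ' * t) / 2 = -(ρ' / 2 * t) := fun t => by ring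
  have hforce : ∀ t ≥ (0 : ℝ), |α * (β - (1 - lam * γ) * mX t)| ≤
      α * (β + |1 - lam * γ| * M) * Real.exp (ρ' / 2 * t) := fun t ht => by
    have hmXt : |mX t| ≤ M * Real.exp (ρ' / 2 * t) := by
      have := hM t ht
      rwa [hdiv, Real.exp_neg, inv_mul_le_iff₀ (Real.exp_pos _), mul_comm] at this
    have hexp : 1 ≤ Real.exp (ρ' / 2 * t) := Real.one_le_exp (by positivity)
    rw [abs_mul, abs_of_pos hα, mul_assoc]
    refine mul_le_mul_of_nonneg_left ?_ hα.le
    calc _ ≤ |β| + |(1 - lam * γ) * mX t| := abs_sub _ _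
      _ ≤ β * Real.exp (ρ' / 2 * t) + |1 - lam * γ| * (M * Real.exp (ρ' / 2 * t)) := by
        rw [abs_mul, abs_of_pos hβ]
        gcongr
        exact le_mul_of_one_le_right hβ.le hexp
      _ = _ := by ring
  obtain ⟨K, hmPK⟩ : ∃ K, ∀ t ≥ (0 : ℝ), |mP t| ≤ K * Real.exp (ρ' / 2 * t) :=
    ⟨_, fun t ht => abs_le_mul_exp_of_hasDerivWithinAt_sub_mul (a := α) (by positivity)
      (fun t ht => (hODE t ht).congr_deriv (by ring)) hforce ht⟩
  have hlt : ρ' / 2 < μ + ρ := by linarith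
  have hmPc : ContinuousOn mP (Ici 0) := hmPC1.continuousOn
  have htail := continuousOn_integral_Ioi_exp_mul hlt hmPc hmPK
  have hL' : ∀ t ≥ (0 : ℝ), HasDerivWithinAt L ((1 - c) / (2 * r) *
      (∫ v in Ioi t, Real.exp (-(μ + ρ) * (v - t)) * mP v) - μ * L t) (Ici 0) t := fun t ht => by
    rw [funext hL]
    exact hasDerivWithinAt_variation_of_constants htail μ x₀ ((1 - c) / (2 * r)) ht
  have hforceL : ∀ t ≥ (0 : ℝ), |(1 - c) / (2 * r) *
      ∫ v in Ioi t, Real.exp (-(μ + ρ) * (v - t)) * mP v| ≤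
      |(1 - c) / (2 * r)| * (K / (μ + ρ - ρ' / 2)) * Real.exp (ρ' / 2 * t) := fun t ht => by
    rw [abs_mul, mul_assoc]
    exact mul_le_mul_of_nonneg_left (abs_integral_Ioi_exp_mul_le hlt hmPK ht) (abs_nonneg _)
  refine ⟨fun s hs => integrableOn_Ioi_exp_mul hlt hmPc hmPK hs, fun t ht => ?_,
    fun t ht => (hL' t ht).continuousWithinAt, ρ', ⟨hρ'0, hρ'⟩,
    |L 0| + |(1 - c) / (2 * r)| * (K / (μ + ρ - ρ' / 2)) / (μ + ρ' / 2), fun t ht => ?_⟩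
  · refine ContinuousOn.intervalIntegrable ?_
    rw [uIcc_of_le ht]
    exact ContinuousOn.mul (by fun_prop) (htail.mono Icc_subset_Ici_self)
  · rw [hdiv, Real.exp_neg, inv_mul_le_iff₀ (Real.exp_pos _), mul_comm]
    exact abs_le_mul_exp_of_hasDerivWithinAt_sub_mul (by positivity) hL' hforceL ht
end

section
/- Let ρ>0, μ>0, α>0, β>0, λ>0, γ>0, r>0, c ∈ (0,1) with 1−λγ > 0, and let x₀, p₀ ∈ ℝ. Then there exists a unique triple (P, X, U) of bounded continuously differentiable functions from [0,∞) to ℝ satisfying the system: P′(t) = α(β − (1−λγ) X(t) − P(t)) with P(0) = p₀; X′(t) = −μ X(t) + U(t) with X(0) = x₀; and U′(t) = (μ+ρ) U(t) − ((1−c)/(2r)) P(t) with U(0) = ((1−c)/(2r)) ∫_0^∞ e^{−(μ+ρ)t} P(t) dt. -/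
open MeasureTheory Set

/-- The triple `(P, X, U)` of bounded C¹ functions on `[0,∞)` solves the coupled system
of Theorem 3.1 (Eq. (3.9)) of the paper. -/
def IsBoundedSolutionTriple (ρ μ α β lam γ r c x₀ p₀ : ℝ) (P X U : ℝ → ℝ) : Prop :=
  (∃ M : ℝ, ∀ t ≥ (0 : ℝ), |P t| ≤ M) ∧
  (∃ M : ℝ, ∀ t ≥ (0 : ℝ), |X t| ≤ M) ∧
  (∃ M : ℝ, ∀ t ≥ (0 : ℝ), |U t| ≤ M) ∧
  ContDiffOn ℝ 1 P (Ici 0) ∧ ContDiffOn ℝ 1 X (Ici 0) ∧ ContDiffOn ℝ 1 U (Ici 0) ∧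
  (∀ t ≥ (0 : ℝ),
    HasDerivWithinAt P (α * (β - (1 - lam * γ) * X t - P t)) (Ici 0) t) ∧
  (∀ t ≥ (0 : ℝ), HasDerivWithinAt X (-μ * X t + U t) (Ici 0) t) ∧
  (∀ t ≥ (0 : ℝ),
    HasDerivWithinAt U ((μ + ρ) * U t - ((1 - c) / (2 * r)) * P t) (Ici 0) t) ∧
  P 0 = p₀ ∧ X 0 = x₀ ∧
  U 0 = ((1 - c) / (2 * r)) * ∫ t in Ioi (0 : ℝ), Real.exp (-(μ + ρ) * t) * P t

/-- A function on `[0,∞)` with nonpositive derivative is bounded above by its initial value. -/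
lemma le_zero_value_of_hasDerivWithinAt_nonpos {f f' : ℝ → ℝ}
    (hf : ∀ t ≥ (0 : ℝ), HasDerivWithinAt f (f' t) (Ici 0) t) (hf' : ∀ t ≥ (0 : ℝ), f' t ≤ 0)
    {t : ℝ} (ht : 0 ≤ t) : f t ≤ f 0 := by
  refine antitoneOn_of_hasDerivWithinAt_nonpos (convex_Ici 0)
    (fun t ht => (hf t ht).continuousWithinAt)
    (fun t ht => (hf t (interior_subset ht)).mono interior_subset)
    (fun t ht => hf' t (interior_subset ht)) (mem_Ici.2 le_rfl) (mem_Ici.2 ht) ht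

/-- A bounded solution of `f' = σ f` on `[0,∞)` with `σ > 0` vanishes. -/
lemma eq_zero_of_bounded_of_hasDerivWithinAt {f : ℝ → ℝ} {σ M : ℝ} (hσ : 0 < σ)
    (hf : ∀ t ≥ (0 : ℝ), HasDerivWithinAt f (σ * f t) (Ici 0) t)
    (hM : ∀ t ≥ (0 : ℝ), |f t| ≤ M) {t : ℝ} (ht : 0 ≤ t) : f t = 0 := by
  have hexp : ∀ t : ℝ, HasDerivAt (fun t => Real.exp (-σ * t)) (Real.exp (-σ * t) * (-σ)) t :=
    fun t => by simpa using ((hasDerivAt_id t).const_mul (-σ)).exp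
  have hd : ∀ t ≥ (0 : ℝ), HasDerivWithinAt (fun t => Real.exp (-σ * t) * f t) 0 (Ici 0) t := by
    intro t ht
    refine ((hexp t).hasDerivWithinAt.mul (hf t ht)).congr_deriv ?_
    ring
  have hconst : ∀ t ≥ (0 : ℝ), Real.exp (-σ * t) * f t = f 0 := by
    intro t ht
    have h1 := le_zero_value_of_hasDerivWithinAt_nonpos hd (fun _ _ => le_rfl) ht
    have h2 := le_zero_value_of_hasDerivWithinAt_nonpos (fun t ht => (hd t ht).neg)
      (fun _ _ => by simp) ht
    simp at h1 h2
    simp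
    linarith
  have hlim : Filter.Tendsto (fun t : ℝ => M * Real.exp (-σ * t)) Filter.atTop (nhds 0) := by
    have : Filter.Tendsto (fun t : ℝ => -σ * t) Filter.atTop Filter.atBot :=
      Filter.tendsto_id.const_mul_atTop_of_neg (by linarith)
    simpa using (Real.tendsto_exp_atBot.comp this).const_mul M
  have h0 : |f 0| ≤ 0 := by
    refine ge_of_tendsto hlim ?_
    filter_upwards [Filter.eventually_ge_atTop 0] with s hs
    rw [← hconst s hs, abs_mul, abs_of_pos (Real.exp_pos _), mul_comm]
    exact mul_le_mul_of_nonneg_right (hM s hs) (Real.exp_pos _).le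
  have h := hconst t ht
  rw [abs_nonpos_iff.1 h0] at h
  exact (mul_eq_zero.1 h).resolve_left (Real.exp_pos _).ne'

/-- If `f' = b f - g` on `[0,∞)` with `b > 0` and `f, g` bounded, then `f 0` is the discounted
integral of `g`. -/
lemma integral_exp_mul_eq_of_bounded {f g : ℝ → ℝ} {b M N : ℝ} (hb : 0 < b)
    (hf : ∀ t, HasDerivAt f (b * f t - g t) t) (hg : Continuous g)
    (hM : ∀ t ≥ (0 : ℝ), |f t| ≤ M) (hN : ∀ t ≥ (0 : ℝ), |g t| ≤ N) :
    f 0 = ∫ t in Ioi (0 : ℝ), Real.exp (-b * t) * g t := by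
  have hexp : ∀ t : ℝ, HasDerivAt (fun t => Real.exp (-b * t)) (Real.exp (-b * t) * (-b)) t :=
    fun t => by simpa using ((hasDerivAt_id t).const_mul (-b)).exp
  have hd : ∀ t ∈ Ici (0 : ℝ), HasDerivAt (fun t => -(Real.exp (-b * t) * f t))
      (Real.exp (-b * t) * g t) t := by
    intro t _
    refine ((hexp t).mul (hf t)).neg.congr_deriv ?_
    ring
  have hlim : Filter.Tendsto (fun t : ℝ => M * Real.exp (-b * t)) Filter.atTop (nhds 0) := by
    have : Filter.Tendsto (fun t : ℝ => -b * t) Filter.atTop Filter.atBot :=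
      Filter.tendsto_id.const_mul_atTop_of_neg (by linarith)
    simpa using (Real.tendsto_exp_atBot.comp this).const_mul M
  have htend : Filter.Tendsto (fun t => -(Real.exp (-b * t) * f t)) Filter.atTop (nhds 0) := by
    refine squeeze_zero_norm' ?_ hlim
    filter_upwards [Filter.eventually_ge_atTop 0] with s hs
    rw [norm_neg, Real.norm_eq_abs, abs_mul, abs_of_pos (Real.exp_pos _), mul_comm]
    exact mul_le_mul_of_nonneg_right (hM s hs) (Real.exp_pos _).le
  have hint : IntegrableOn (fun t => Real.exp (-b * t) * g t) (Ioi 0) := by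
    refine Integrable.mono' ((exp_neg_integrableOn_Ioi 0 hb).mul_const N)
      (by fun_prop) ?_
    refine (ae_restrict_mem measurableSet_Ioi).mono fun s hs => ?_
    rw [Real.norm_eq_abs, abs_mul, abs_of_pos (Real.exp_pos _)]
    exact mul_le_mul_of_nonneg_left (hN s (mem_Ioi.1 hs).le) (Real.exp_pos _).le
  rw [integral_Ioi_of_hasDerivAt_of_tendsto' hd hint htend]
  simp

/-- Global solvability of planar linear systems with constant coefficients. -/
lemma exists_planar_linear_solution (a b c d x y : ℝ) :
    ∃ f g : ℝ → ℝ, f 0 = x ∧ g 0 = y ∧ (∀ t, HasDerivAt f (a * f t + b * g t) t) ∧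
      ∀ t, HasDerivAt g (c * f t + d * g t) t := by
  let F := ContinuousLinearMap.fst ℝ ℝ ℝ
  let G := ContinuousLinearMap.snd ℝ ℝ ℝ
  let A : ℝ × ℝ →L[ℝ] ℝ × ℝ := (a • F + b • G).prod (c • F + d • G)
  have h : ∀ t : ℝ, HasDerivAt (fun t : ℝ => NormedSpace.exp (t • A) (x, y))
      (A (NormedSpace.exp (t • A) (x, y))) t := fun t => by
    have h1 := ((ContinuousLinearMap.apply ℝ (ℝ × ℝ) (x, y)).hasFDerivAt).comp_hasDerivAt t
      (hasDerivAt_exp_smul_const' A t)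
    exact h1
  refine ⟨fun t => (NormedSpace.exp (t • A) (x, y)).1, fun t => (NormedSpace.exp (t • A) (x, y)).2,
    by simp, by simp, fun t => ?_, fun t => ?_⟩
  · exact F.hasFDerivAt.comp_hasDerivAt t (h t)
  · exact G.hasFDerivAt.comp_hasDerivAt t (h t)

/-- The characteristic equation of the system has a root above `b`. -/
lemma exists_characteristic_root {α a b q : ℝ} (hα : 0 < α) (ha : 0 < a) (hb : 0 < b)
    (hq : 0 < q) : ∃ σ, b ≤ σ ∧ (σ - b) * (σ + α) * (σ + a) = α * q := by
  have hqa : 0 < q / a := div_pos hq ha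
  have h := intermediate_value_Icc (f := fun s : ℝ => (s - b) * (s + α) * (s + a))
    (show b ≤ b + q / a by linarith) (by fun_prop)
  have hmem : α * q ∈ Icc ((b - b) * (b + α) * (b + a))
      ((b + q / a - b) * (b + q / a + α) * (b + q / a + a)) := by
    refine ⟨by simp; positivity, ?_⟩
    calc α * q = q / a * α * a := by field_simp
      _ ≤ q / a * (b + q / a + α) * (b + q / a + a) := by gcongr <;> linarith
      _ = _ := by ring
  obtain ⟨σ, hσ, he⟩ := h hmem
  exact ⟨σ, hσ.1, he⟩

/-- Along the planar system `p' = -α p - α k x`, `x' = e p - m x` the quadratic form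
`e p² + α k x²` does not increase. -/
lemma planar_lyapunov {α k e m : ℝ} (hα : 0 < α) (hk : 0 < k) (he : 0 < e) (hm : 0 < m)
    {p x : ℝ → ℝ} (hp : ∀ t ≥ (0 : ℝ), HasDerivWithinAt p (-α * p t + -(α * k) * x t) (Ici 0) t)
    (hx : ∀ t ≥ (0 : ℝ), HasDerivWithinAt x (e * p t + -m * x t) (Ici 0) t)
    {t : ℝ} (ht : 0 ≤ t) :
    e * p t ^ 2 + α * k * x t ^ 2 ≤ e * p 0 ^ 2 + α * k * x 0 ^ 2 := by
  refine le_zero_value_of_hasDerivWithinAt_nonpos (f := fun t => e * p t ^ 2 + α * k * x t ^ 2)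
    (f' := fun t => -(2 * (e * α * p t ^ 2 + α * k * m * x t ^ 2))) (fun t ht => ?_)
    (fun t _ => neg_nonpos.2 (by positivity)) ht
  refine ((((hp t ht).pow 2).const_mul e).add (((hx t ht).pow 2).const_mul (α * k))).congr_deriv ?_
  push_cast
  ring

lemma abs_le_of_mul_sq_le {e y C : ℝ} (he : 0 < e) (h : e * y ^ 2 ≤ C) :
    |y| ≤ √(C / e) :=
  Real.abs_le_sqrt ((le_div_iff₀ he).2 (by linarith))

lemma contDiff_one_of_hasDerivAt {f f' : ℝ → ℝ} (h : ∀ t, HasDerivAt f (f' t) t)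
    (hf' : Continuous f') : ContDiff ℝ 1 f := by
  rw [contDiff_one_iff_deriv]
  refine ⟨fun t => (h t).differentiableAt, ?_⟩
  rwa [show deriv f = f' from funext fun t => (h t).deriv]

/-- Existence and uniqueness (on `[0,∞)`) of a bounded C¹ solution triple
of the system `P' = α(β − (1−λγ)X − P)`, `X' = −μX + U`, `U' = (μ+ρ)U − ((1−c)/(2r))P`
with the stated initial conditions. -/
theorem stmt_7 (ρ μ α β lam γ r c x₀ p₀ : ℝ)
    (hρ : 0 < ρ) (hμ : 0 < μ) (hα : 0 < α) (hβ : 0 < β) (hlam : 0 < lam) (hγ : 0 < γ)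
    (hr : 0 < r) (hc : c ∈ Ioo (0 : ℝ) 1) (hlg : 0 < 1 - lam * γ) :
    (∃ P X U : ℝ → ℝ, IsBoundedSolutionTriple ρ μ α β lam γ r c x₀ p₀ P X U) ∧
    ∀ P₁ X₁ U₁ P₂ X₂ U₂ : ℝ → ℝ,
      IsBoundedSolutionTriple ρ μ α β lam γ r c x₀ p₀ P₁ X₁ U₁ →
      IsBoundedSolutionTriple ρ μ α β lam γ r c x₀ p₀ P₂ X₂ U₂ →
      EqOn P₁ P₂ (Ici 0) ∧ EqOn X₁ X₂ (Ici 0) ∧ EqOn U₁ U₂ (Ici 0) := by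
  have hd : 0 < (1 - c) / (2 * r) := div_pos (by linarith [hc.2]) (by linarith)
  unfold IsBoundedSolutionTriple
  generalize (1 - c) / (2 * r) = d at hd ⊢
  generalize 1 - lam * γ = k at hlg ⊢
  have hb : 0 < μ + ρ := by linarith
  generalize μ + ρ = b at hb ⊢
  obtain ⟨σ, hbσ, hroot⟩ := exists_characteristic_root hα hμ hb (mul_pos hlg hd)
  have hσ : 0 < σ := hb.trans_le hbσ
  obtain ⟨e, he, hed⟩ : ∃ e, 0 < e ∧ e * (σ + α) = d :=
    ⟨d / (σ + α), by positivity, by field_simp⟩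
  -- `(-e, σ - b, 1)` is a left eigenvector of the system for the eigenvalue `σ`.
  have hw : (σ - b) * (σ + μ) = α * k * e := by
    have : σ + α ≠ 0 := by positivity
    apply mul_right_cancel₀ this
    linear_combination hroot - α * k * hed
  have hm : 0 < μ + (σ - b) := by linarith
  constructor
  · have hdet : 0 < (μ + (σ - b)) + k * e := by positivity
    set C := e * α * β / σ with hC
    have hCσ : C * σ = e * α * β := by rw [hC]; field_simp
    -- the equilibrium of the planar system
    obtain ⟨x', hx'⟩ : ∃ x', x' * ((μ + (σ - b)) + k * e) = e * β + C :=
      ⟨(e * β + C) / ((μ + (σ - b)) + k * e), by field_simp⟩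
    set p' := β - k * x' with hp'
    obtain ⟨f, g, hf0, hg0, hf, hg⟩ := exists_planar_linear_solution (-α) (-(α * k)) e
      (-(μ + (σ - b))) (p₀ - p') (x₀ - x')
    have hV : ∀ t ≥ (0 : ℝ), _ := fun t ht =>
      planar_lyapunov hα hlg he hm (fun t _ => (hf t).hasDerivWithinAt)
        (fun t _ => (hg t).hasDerivWithinAt) ht
    set V := e * f 0 ^ 2 + α * k * g 0 ^ 2
    have hfb : ∀ t ≥ (0 : ℝ), |f t| ≤ √(V / e) := fun t ht =>
      abs_le_of_mul_sq_le he (by have := hV t ht; have : 0 ≤ α * k * g t ^ 2 := by positivity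
                                 linarith)
    have hgb : ∀ t ≥ (0 : ℝ), |g t| ≤ √(V / (α * k)) := fun t ht =>
      abs_le_of_mul_sq_le (by positivity)
        (by have := hV t ht; have : 0 ≤ e * f t ^ 2 := by positivity
            linarith)
    obtain ⟨P, hP⟩ : ∃ P : ℝ → ℝ, ∀ t, P t = f t + p' := ⟨_, fun _ => rfl⟩
    obtain ⟨X, hX⟩ : ∃ X : ℝ → ℝ, ∀ t, X t = g t + x' := ⟨_, fun _ => rfl⟩
    obtain ⟨U, hU⟩ : ∃ U : ℝ → ℝ, ∀ t, U t = e * P t - (σ - b) * X t + C := ⟨_, fun _ => rfl⟩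
    have hPd : ∀ t, HasDerivAt P (α * (β - k * X t - P t)) t := fun t => by
      rw [funext hP]
      refine ((hf t).add_const p').congr_deriv ?_
      rw [hX, hp']
      ring
    have hXd : ∀ t, HasDerivAt X (-μ * X t + U t) t := fun t => by
      refine (((hg t).add_const x').congr_deriv ?_).congr_of_eventuallyEq (.of_forall hX)
      rw [hU, hX, hP, hp']
      linear_combination hx'
    have hUd : ∀ t, HasDerivAt U (b * U t - d * P t) t := fun t => by
      refine (((((hPd t).const_mul e).sub ((hXd t).const_mul (σ - b))).add_const C).congr_deriv
        ?_).congr_of_eventuallyEq (.of_forall hU)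
      rw [hU]
      linear_combination -hCσ - P t * hed + X t * hw
    have hPc : Continuous P := continuous_iff_continuousAt.2 fun t => (hPd t).continuousAt
    have hXc : Continuous X := continuous_iff_continuousAt.2 fun t => (hXd t).continuousAt
    have hUc : Continuous U := continuous_iff_continuousAt.2 fun t => (hUd t).continuousAt
    have hPb : ∃ M, ∀ t ≥ (0 : ℝ), |P t| ≤ M := ⟨√(V / e) + |p'|, fun t ht => by
      rw [hP]
      exact (abs_add_le _ _).trans (by gcongr; exact hfb t ht)⟩
    have hXb : ∃ M, ∀ t ≥ (0 : ℝ), |X t| ≤ M := ⟨√(V / (α * k)) + |x'|, fun t ht => by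
      rw [hX]
      exact (abs_add_le _ _).trans (by gcongr; exact hgb t ht)⟩
    obtain ⟨MP, hMP⟩ := hPb
    obtain ⟨MX, hMX⟩ := hXb
    have hMU : ∀ t ≥ (0 : ℝ), |U t| ≤ e * MP + (σ - b) * MX + |C| := fun t ht => by
      have h1 : |e * P t| ≤ e * MP := by
        rw [abs_mul, abs_of_pos he]; exact mul_le_mul_of_nonneg_left (hMP t ht) he.le
      have h2 : |(σ - b) * X t| ≤ (σ - b) * MX := by
        rw [abs_mul, abs_of_nonneg (sub_nonneg.2 hbσ)]
        exact mul_le_mul_of_nonneg_left (hMX t ht) (sub_nonneg.2 hbσ)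
      rw [hU]
      exact (abs_add_le _ _).trans (by gcongr; exact (abs_sub _ _).trans (add_le_add h1 h2))
    refine ⟨P, X, U, ⟨MP, hMP⟩, ⟨MX, hMX⟩, ⟨_, hMU⟩,
      (contDiff_one_of_hasDerivAt hPd (by fun_prop)).contDiffOn,
      (contDiff_one_of_hasDerivAt hXd (by fun_prop)).contDiffOn,
      (contDiff_one_of_hasDerivAt hUd (by fun_prop)).contDiffOn,
      fun t _ => (hPd t).hasDerivWithinAt, fun t _ => (hXd t).hasDerivWithinAt,
      fun t _ => (hUd t).hasDerivWithinAt, by rw [hP, hf0]; ring, by rw [hX, hg0]; ring, ?_⟩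
    rw [integral_exp_mul_eq_of_bounded hb hUd (hPc.const_mul d) hMU (N := d * MP)
      fun t ht => by
        rw [abs_mul, abs_of_pos hd]; exact mul_le_mul_of_nonneg_left (hMP t ht) hd.le,
      ← integral_const_mul]
    congr 1 with t
    ring
  · rintro P₁ X₁ U₁ P₂ X₂ U₂ ⟨⟨MP₁, hMP₁⟩, ⟨MX₁, hMX₁⟩, ⟨MU₁, hMU₁⟩, -, -, -, hP₁, hX₁, hU₁,
      hP₁0, hX₁0, -⟩ ⟨⟨MP₂, hMP₂⟩, ⟨MX₂, hMX₂⟩, ⟨MU₂, hMU₂⟩, -, -, -, hP₂, hX₂, hU₂,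
      hP₂0, hX₂0, -⟩
    have hL : ∀ t ≥ (0 : ℝ),
        (-e * (P₁ t - P₂ t) + (σ - b) * (X₁ t - X₂ t)) + (U₁ t - U₂ t) = 0 := by
      intro t ht
      refine eq_zero_of_bounded_of_hasDerivWithinAt
        (M := e * (MP₁ + MP₂) + (σ - b) * (MX₁ + MX₂) + (MU₁ + MU₂))
        (f := fun t => (-e * (P₁ t - P₂ t) + (σ - b) * (X₁ t - X₂ t)) + (U₁ t - U₂ t)) hσ
        (fun t ht => ?_) (fun t ht => ?_) ht
      · refine (((((hP₁ t ht).sub (hP₂ t ht)).const_mul (-e)).add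
          (((hX₁ t ht).sub (hX₂ t ht)).const_mul (σ - b))).add
          ((hU₁ t ht).sub (hU₂ t ht))).congr_deriv ?_
        linear_combination (P₁ t - P₂ t) * hed - (X₁ t - X₂ t) * hw
      · have hσb := sub_nonneg.2 hbσ
        have hsub : ∀ {y z A B : ℝ}, |y| ≤ A → |z| ≤ B → |y - z| ≤ A + B :=
          fun hy hz => (abs_sub _ _).trans (add_le_add hy hz)
        refine (abs_add_le _ _).trans (add_le_add ((abs_add_le _ _).trans (add_le_add ?_ ?_))
          (hsub (hMU₁ t ht) (hMU₂ t ht)))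
        · rw [abs_mul, abs_neg, abs_of_pos he]
          exact mul_le_mul_of_nonneg_left (hsub (hMP₁ t ht) (hMP₂ t ht)) he.le
        · rw [abs_mul, abs_of_nonneg hσb]
          exact mul_le_mul_of_nonneg_left (hsub (hMX₁ t ht) (hMX₂ t ht)) hσb
    have hV : ∀ t ≥ (0 : ℝ), e * (P₁ t - P₂ t) ^ 2 + α * k * (X₁ t - X₂ t) ^ 2 ≤ 0 := by
      intro t ht
      refine (planar_lyapunov (p := fun t => P₁ t - P₂ t) (x := fun t => X₁ t - X₂ t)
        hα hlg he hm (fun t ht => ?_) (fun t ht => ?_) ht).trans (by simp [*])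
      · exact ((hP₁ t ht).sub (hP₂ t ht)).congr_deriv (by ring)
      · exact ((hX₁ t ht).sub (hX₂ t ht)).congr_deriv (by linear_combination hL t ht)
    have hP : ∀ t ≥ (0 : ℝ), P₁ t - P₂ t = 0 := fun t ht => by
      have h := hV t ht
      have h2 : 0 ≤ α * k * (X₁ t - X₂ t) ^ 2 := by positivity
      have h3 := abs_le_of_mul_sq_le (C := 0) he (y := P₁ t - P₂ t) (by linarith)
      simpa using h3
    have hX : ∀ t ≥ (0 : ℝ), X₁ t - X₂ t = 0 := fun t ht => by
      have h := hV t ht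
      have h2 : 0 ≤ e * (P₁ t - P₂ t) ^ 2 := by positivity
      have h3 := abs_le_of_mul_sq_le (C := 0) (mul_pos hα hlg) (y := X₁ t - X₂ t) (by linarith)
      simpa using h3
    refine ⟨fun t ht => sub_eq_zero.1 (hP t ht), fun t ht => sub_eq_zero.1 (hX t ht),
      fun t ht => sub_eq_zero.1 ?_⟩
    have h := hL t ht
    rwa [hP t ht, hX t ht, mul_zero, mul_zero, add_zero, zero_add] at h
end

section
/- Let α>0, ρ>0, A>0, B>0 and define f(K) := K³ + (α−ρ)K² − AK − B and Δ := −27B² + (18(α−ρ)A + 4(α−ρ)³)B + (α−ρ)²A² + 4A³. If Δ = 0, then f has exactly two distinct real roots K₁ < 0 < K₂, where K₁ is a double root of f and K₂ is a simple root; in particular f cannot have a triple root. -/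
/-- If the discriminant `Δ` of `f(K) = K³ + (α−ρ)K² − AK − B` vanishes
(with `α, ρ, A, B > 0`), then `f` has exactly two distinct real roots `K₁ < 0 < K₂`,
where `K₁` is a double root (`f(K₁) = f'(K₁) = 0`, `f''(K₁) ≠ 0`) and `K₂` is a simple
root (`f'(K₂) ≠ 0`); in particular `f` has no triple root. -/
theorem stmt_10 (α ρ A B : ℝ) (hα : 0 < α) (hρ : 0 < ρ) (hA : 0 < A) (hB : 0 < B)
    (hΔ : -27 * B ^ 2 + (18 * (α - ρ) * A + 4 * (α - ρ) ^ 3) * B +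
      ((α - ρ) ^ 2 * A ^ 2 + 4 * A ^ 3) = 0) :
    (∃ K₁ K₂ : ℝ, K₁ < 0 ∧ 0 < K₂ ∧
      K₁ ^ 3 + (α - ρ) * K₁ ^ 2 - A * K₁ - B = 0 ∧
      3 * K₁ ^ 2 + 2 * (α - ρ) * K₁ - A = 0 ∧
      6 * K₁ + 2 * (α - ρ) ≠ 0 ∧
      K₂ ^ 3 + (α - ρ) * K₂ ^ 2 - A * K₂ - B = 0 ∧
      3 * K₂ ^ 2 + 2 * (α - ρ) * K₂ - A ≠ 0 ∧
      ∀ K : ℝ, K ^ 3 + (α - ρ) * K ^ 2 - A * K - B = 0 → K = K₁ ∨ K = K₂) ∧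
    ¬ ∃ K : ℝ, K ^ 3 + (α - ρ) * K ^ 2 - A * K - B = 0 ∧
      3 * K ^ 2 + 2 * (α - ρ) * K - A = 0 ∧ 6 * K + 2 * (α - ρ) = 0 := by
  set p := α - ρ with hp
  clear_value p
  have hD : 0 < p ^ 2 + 3 * A := by positivity
  obtain ⟨r, hr⟩ : ∃ r : ℝ, 2 * (p ^ 2 + 3 * A) * r = p * A - 9 * B :=
    ⟨(p * A - 9 * B) / (2 * (p ^ 2 + 3 * A)), by field_simp⟩
  have hf' : 3 * r ^ 2 + 2 * p * r - A = 0 := by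
    have h : 4 * (p ^ 2 + 3 * A) ^ 2 * (3 * r ^ 2 + 2 * p * r - A) = 0 := by
      linear_combination (-9) * hΔ + (3 * (2 * (p ^ 2 + 3 * A) * r + (p * A - 9 * B)) +
        4 * p * (p ^ 2 + 3 * A)) * hr
    exact (mul_eq_zero.mp h).resolve_left (by positivity)
  have hf : r ^ 3 + p * r ^ 2 - A * r - B = 0 := by
    linear_combination (r / 3 + p / 9) * hf' - hr / 9
  obtain ⟨s, hs⟩ : ∃ s : ℝ, s = -p - 2 * r := ⟨_, rfl⟩
  have hprod : r ^ 2 * s = B := by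
    subst hs; linear_combination hf - r * hf'
  have hsum : r * (r + 2 * s) = -A := by
    subst hs; linear_combination -hf'
  have hs0 : 0 < s := pos_of_mul_pos_right (hprod ▸ hB) (sq_nonneg r)
  have hr0 : r < 0 := by
    by_contra! h
    have : 0 ≤ r * (r + 2 * s) := by positivity
    linarith
  have hpoly (K : ℝ) : K ^ 3 + p * K ^ 2 - A * K - B = (K - r) ^ 2 * (K - s) := by
    subst hs; linear_combination (K - r) * hf' + hf
  refine ⟨⟨r, s, hr0, hs0, hf, hf', ?_, by simp [hpoly], ?_, fun K hK => ?_⟩, ?_⟩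
  · have : 6 * r + 2 * p = 2 * (r - s) := by rw [hs]; ring
    linarith
  · have : 3 * s ^ 2 + 2 * p * s - A = (s - r) ^ 2 := by
      subst hs; linear_combination hf'
    rw [this]
    exact pow_ne_zero 2 (by linarith)
  · rw [hpoly] at hK
    simpa [sub_eq_zero] using hK
  · rintro ⟨K, -, h1, h2⟩
    have : A = -3 * K ^ 2 := by linear_combination K * h2 - h1
    nlinarith [sq_nonneg K]
end

section
/- Let α>0, ρ>0, A>0, B>0 and define f(K) := K³ + (α−ρ)K² − AK − B and Δ := −27B² + (18(α−ρ)A + 4(α−ρ)³)B + (α−ρ)²A² + 4A³. If Δ < 0, then f has exactly one real root K₃, which satisfies K₃ > 0, and the two remaining (complex conjugate) roots K_R ± i K_I of f over ℂ satisfy K_R < 0 and K_I ≠ 0. -/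
/-- A monic real cubic whose linear and constant coefficients are negative has a positive root. -/
theorem exists_pos_root_cubic (a A B : ℝ) (hA : 0 < A) (hB : 0 < B) :
    ∃ k : ℝ, 0 < k ∧ k ^ 3 + a * k ^ 2 - A * k - B = 0 := by
  set M : ℝ := 1 + |a| + A + B with hM
  have ha := abs_nonneg a
  have hM1 : 1 ≤ M := by linarith
  have hfM : 0 ≤ M ^ 3 + a * M ^ 2 - A * M - B := by
    have h1 : 0 ≤ (a + |a|) * M ^ 2 :=
      mul_nonneg (by linarith [neg_abs_le a]) (sq_nonneg M)
    have h2 : 0 ≤ A * (M ^ 2 - M) := mul_nonneg hA.le (by nlinarith)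
    have h3 : 0 ≤ B * (M ^ 2 - 1) := mul_nonneg hB.le (by nlinarith)
    have h4 : M ^ 3 = M ^ 2 + |a| * M ^ 2 + A * M ^ 2 + B * M ^ 2 := by
      rw [pow_succ M 2]
      nth_rewrite 2 [hM]
      ring
    nlinarith [sq_nonneg M]
  have hcont : ContinuousOn (fun x : ℝ => x ^ 3 + a * x ^ 2 - A * x - B) (Set.Icc 0 M) := by
    fun_prop
  obtain ⟨k, hk, hfk⟩ := intermediate_value_Icc (by linarith) hcont
    (show (0 : ℝ) ∈ Set.Icc _ _ from ⟨by simp [hB.le], hfM⟩)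
  refine ⟨k, lt_of_le_of_ne hk.1 ?_, hfk⟩
  rintro rfl
  simp [hB.ne'] at hfk


/-- If the discriminant `Δ` of `f(K) = K³ + (α−ρ)K² − AK − B` is negative
(with `α, ρ, A, B > 0`), then `f` has exactly one real root `K₃ > 0`, and the remaining
complex conjugate roots `K_R ± i K_I` satisfy `K_R < 0` and `K_I ≠ 0`. -/
theorem stmt_11 (α ρ A B : ℝ) (hα : 0 < α) (hρ : 0 < ρ) (hA : 0 < A) (hB : 0 < B)
    (hΔ : -27 * B ^ 2 + (18 * (α - ρ) * A + 4 * (α - ρ) ^ 3) * B +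
      ((α - ρ) ^ 2 * A ^ 2 + 4 * A ^ 3) < 0) :
    ∃ K₃ KR KI : ℝ, 0 < K₃ ∧
      K₃ ^ 3 + (α - ρ) * K₃ ^ 2 - A * K₃ - B = 0 ∧
      (∀ K : ℝ, K ^ 3 + (α - ρ) * K ^ 2 - A * K - B = 0 → K = K₃) ∧
      KR < 0 ∧ KI ≠ 0 ∧
      ((KR : ℂ) + KI * Complex.I) ^ 3 + ((α : ℂ) - (ρ : ℂ)) * ((KR : ℂ) + KI * Complex.I) ^ 2
        - (A : ℂ) * ((KR : ℂ) + KI * Complex.I) - (B : ℂ) = 0 ∧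
      ((KR : ℂ) - KI * Complex.I) ^ 3 + ((α : ℂ) - (ρ : ℂ)) * ((KR : ℂ) - KI * Complex.I) ^ 2
        - (A : ℂ) * ((KR : ℂ) - KI * Complex.I) - (B : ℂ) = 0 := by
  obtain ⟨k, hk, hfk⟩ := exists_pos_root_cubic (α - ρ) A B hA hB
  -- Divide out the linear factor: `f K = (K - k) * (K ^ 2 + p * K + q)`.
  obtain ⟨p, hp⟩ : ∃ p, p = (α - ρ) + k := ⟨_, rfl⟩
  obtain ⟨q, hq⟩ : ∃ q, q = k * p - A := ⟨_, rfl⟩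
  have ha : α - ρ = p - k := by linarith
  have hA' : A = k * p - q := by linarith
  have hB' : B = k * q := by rw [ha, hA'] at hfk; linear_combination -hfk
  have hq0 : 0 < q := pos_of_mul_pos_right (hB' ▸ hB) hk.le
  have hp0 : 0 < p := pos_of_mul_pos_right (show 0 < k * p by linarith) hk.le
  have hdisc : p ^ 2 - 4 * q < 0 := by
    by_contra! h
    have h1 := mul_nonneg h (sq_nonneg (k ^ 2 + p * k + q))
    rw [ha, hA', hB'] at hΔ
    linarith
  have hI : 0 < √(4 * q - p ^ 2) := Real.sqrt_pos.2 (by linarith)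
  have hsq : ((√(4 * q - p ^ 2) : ℝ) : ℂ) ^ 2 = 4 * q - p ^ 2 := by
    exact_mod_cast Real.sq_sqrt (show 0 ≤ 4 * q - p ^ 2 by linarith)
  have haC : (α : ℂ) - ρ = p - k := by exact_mod_cast ha
  have hfactor (z : ℂ) (hz : z ^ 2 + p * z + q = 0) :
      z ^ 3 + ((α : ℂ) - ρ) * z ^ 2 - A * z - B = 0 := by
    rw [haC, hA', hB']
    push_cast
    linear_combination (z - k) * hz
  refine ⟨k, -p / 2, √(4 * q - p ^ 2) / 2, hk, hfk, fun K hK => ?_, by linarith,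
    by positivity, hfactor _ ?_, hfactor _ ?_⟩
  · rw [ha, hA', hB'] at hK
    have hmul : (K - k) * (K ^ 2 + p * K + q) = 0 := by linear_combination hK
    rcases mul_eq_zero.1 hmul with h | h
    · linarith
    · nlinarith [sq_nonneg (2 * K + p)]
  all_goals
    push_cast
    linear_combination (1 / 4 : ℂ) * Complex.I ^ 2 * hsq +
      (1 / 4 : ℂ) * (4 * q - p ^ 2) * Complex.I_sq
end

section
/- Let ρ>0, μ>0, α>0, β>0, λ>0, γ>0, r>0, c ∈ (0,1) with 1−λγ > 0, and x₀, p₀ ∈ ℝ. Set A := μ² + ρμ + αρ and B := α(μ(μ+ρ) + (1−λγ)(1−c)/(2r)). Suppose (P, X, U) are continuously differentiable functions [0,∞) → ℝ satisfying P′ = α(β − (1−λγ)X − P) with P(0) = p₀, X′ = −μX + U with X(0) = x₀, and U′ = (μ+ρ)U − ((1−c)/(2r))P. Then P is three times continuously differentiable and satisfies the third-order linear ODE P‴(t) + (α−ρ) P″(t) − A P′(t) − B P(t) + αμβ(μ+ρ) = 0 for all t ≥ 0, together with P(0) = p₀ and P′(0) = α(β − (1−λγ)x₀ − p₀). -/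
open Set

theorem ContDiffOn.succ_of_hasDerivWithinAt_Ici {f f' : ℝ → ℝ} {a : ℝ} {n : ℕ}
    (hf : ∀ t ≥ a, HasDerivWithinAt f (f' t) (Ici a) t) (hf' : ContDiffOn ℝ n f' (Ici a)) :
    ContDiffOn ℝ (n + 1) f (Ici a) := by
  rw [contDiffOn_succ_iff_derivWithin (uniqueDiffOn_Ici a)]
  refine ⟨fun t ht => (hf t ht).differentiableWithinAt, by simp, ?_⟩
  exact hf'.congr fun t ht => (hf t ht).derivWithin (uniqueDiffOn_Ici a t ht)

/-- If C¹ functions `(P, X, U)` on `[0,∞)` satisfy the coupled system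
`P' = α(β − (1−λγ)X − P)`, `X' = −μX + U`, `U' = (μ+ρ)U − ((1−c)/(2r))P` with
`P 0 = p₀`, `X 0 = x₀`, then `P` is three times continuously differentiable and solves
`P''' + (α−ρ)P'' − A P' − B P + αμβ(μ+ρ) = 0` on `[0,∞)`, with
`P'(0) = α(β − (1−λγ)x₀ − p₀)`, where `A = μ² + ρμ + αρ` and
`B = α(μ(μ+ρ) + (1−λγ)(1−c)/(2r))`. -/
theorem stmt_12 (ρ μ α β lam γ r c x₀ p₀ : ℝ)
    (hρ : 0 < ρ) (hμ : 0 < μ) (hα : 0 < α) (hβ : 0 < β) (hlam : 0 < lam) (hγ : 0 < γ)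
    (hr : 0 < r) (hc : c ∈ Ioo (0 : ℝ) 1) (hlg : 0 < 1 - lam * γ)
    (P X U : ℝ → ℝ)
    (hPC1 : ContDiffOn ℝ 1 P (Ici 0)) (hXC1 : ContDiffOn ℝ 1 X (Ici 0))
    (hUC1 : ContDiffOn ℝ 1 U (Ici 0))
    (hPode : ∀ t ≥ (0 : ℝ),
      HasDerivWithinAt P (α * (β - (1 - lam * γ) * X t - P t)) (Ici 0) t)
    (hXode : ∀ t ≥ (0 : ℝ), HasDerivWithinAt X (-μ * X t + U t) (Ici 0) t)
    (hUode : ∀ t ≥ (0 : ℝ),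
      HasDerivWithinAt U ((μ + ρ) * U t - ((1 - c) / (2 * r)) * P t) (Ici 0) t)
    (hP0 : P 0 = p₀) (hX0 : X 0 = x₀) :
    ContDiffOn ℝ 3 P (Ici 0) ∧
    ∃ P₁ P₂ P₃ : ℝ → ℝ,
      (∀ t ≥ (0 : ℝ), HasDerivWithinAt P (P₁ t) (Ici 0) t) ∧
      (∀ t ≥ (0 : ℝ), HasDerivWithinAt P₁ (P₂ t) (Ici 0) t) ∧
      (∀ t ≥ (0 : ℝ), HasDerivWithinAt P₂ (P₃ t) (Ici 0) t) ∧
      ContinuousOn P₃ (Ici 0) ∧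
      (∀ t ≥ (0 : ℝ),
        P₃ t + (α - ρ) * P₂ t - (μ ^ 2 + ρ * μ + α * ρ) * P₁ t -
          (α * (μ * (μ + ρ) + (1 - lam * γ) * (1 - c) / (2 * r))) * P t +
          α * μ * β * (μ + ρ) = 0) ∧
      P₁ 0 = α * (β - (1 - lam * γ) * x₀ - p₀) := by
  have hX2 : ContDiffOn ℝ 2 X (Ici 0) := by
    simpa [one_add_one_eq_two] using ContDiffOn.succ_of_hasDerivWithinAt_Ici (n := 1) hXode
      ((contDiffOn_const.mul hXC1).add hUC1)
  have hP2 : ContDiffOn ℝ 2 P (Ici 0) := by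
    simpa [one_add_one_eq_two] using ContDiffOn.succ_of_hasDerivWithinAt_Ici (n := 1) hPode
      (contDiffOn_const.mul ((contDiffOn_const.sub (contDiffOn_const.mul hXC1)).sub hPC1))
  have hP3 : ContDiffOn ℝ 3 P (Ici 0) := by
    have h := ContDiffOn.succ_of_hasDerivWithinAt_Ici (n := 2) hPode
      (contDiffOn_const.mul ((contDiffOn_const.sub (contDiffOn_const.mul hX2)).sub hP2))
    norm_num at h
    exact h
  have hPc := hPC1.continuousOn
  have hXc := hXC1.continuousOn
  have hUc := hUC1.continuousOn
  refine ⟨hP3, fun t => α * (β - (1 - lam * γ) * X t - P t),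
    fun t => α * (-((1 - lam * γ) * (-μ * X t + U t)) - α * (β - (1 - lam * γ) * X t - P t)),
    fun t => α * (-((1 - lam * γ) * (-μ * (-μ * X t + U t) +
        ((μ + ρ) * U t - ((1 - c) / (2 * r)) * P t))) -
      α * (-((1 - lam * γ) * (-μ * X t + U t)) - α * (β - (1 - lam * γ) * X t - P t))),
    hPode, fun t ht => ?_, fun t ht => ?_, by fun_prop, fun t _ => by ring, by simp [hP0, hX0]⟩
  · exact ((((hXode t ht).const_mul _).const_sub β).sub (hPode t ht)).const_mul α
  · exact (((((hXode t ht).const_mul (-μ)).add (hUode t ht)).const_mul _).neg.sub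
      (((((hXode t ht).const_mul _).const_sub β).sub (hPode t ht)).const_mul α)).const_mul α
end

section
/- Let ρ>0, μ>0, α>0, β>0, λ>0, γ>0, r>0, c ∈ (0,1) with 1−λγ > 0, and x₀, p₀ ∈ ℝ. Set A := μ² + ρμ + αρ, B := α(μ(μ+ρ) + (1−λγ)(1−c)/(2r)), p* := αμβ(μ+ρ)/B, and Φ := β − (1−λγ)x₀ − p₀. Suppose the cubic K³ + (α−ρ)K² − AK − B has three distinct real roots K₁ < K₂ < 0 < K₃. Then the function P(t) := ((−αΦ + (p₀−p*)K₂)/(K₂−K₁)) e^{K₁t} + ((αΦ − (p₀−p*)K₁)/(K₂−K₁)) e^{K₂t} + p* is bounded on [0,∞), infinitely differentiable, and satisfies P‴ + (α−ρ)P″ − AP′ − BP + αμβ(μ+ρ) = 0 on [0,∞) with P(0) = p₀ and P′(0) = αΦ. -/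
theorem deriv_exp_add_exp_add_const (a b k l d : ℝ) :
    deriv (fun t : ℝ => a * Real.exp (k * t) + b * Real.exp (l * t) + d) =
      fun t => a * k * Real.exp (k * t) + b * l * Real.exp (l * t) + 0 := by
  have hexp (m t : ℝ) : HasDerivAt (fun t : ℝ => Real.exp (m * t)) (Real.exp (m * t) * m) t := by
    simpa using ((hasDerivAt_id t).const_mul m).exp
  funext t
  refine ((((hexp k t).const_mul a).add ((hexp l t).const_mul b)).add_const d).deriv.trans ?_
  ring

theorem abs_exp_add_exp_add_const_le (a b d : ℝ) {k l t : ℝ} (hk : k ≤ 0) (hl : l ≤ 0)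
    (ht : 0 ≤ t) :
    |a * Real.exp (k * t) + b * Real.exp (l * t) + d| ≤ |a| + |b| + |d| := by
  have hexp (c : ℝ) {m : ℝ} (hm : m ≤ 0) : |c * Real.exp (m * t)| ≤ |c| := by
    rw [abs_mul, Real.abs_exp]
    exact mul_le_of_le_one_right (abs_nonneg c)
      (Real.exp_le_one_iff.2 (mul_nonpos_of_nonpos_of_nonneg hm ht))
  exact (abs_add_three _ _ _).trans
    (add_le_add (add_le_add (hexp a hk) (hexp b hl)) le_rfl)

/-- case Δ > 0: with `A = μ² + ρμ + αρ`, `B = α(μ(μ+ρ) + (1−λγ)(1−c)/(2r))`,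
`p* = αμβ(μ+ρ)/B`, `Φ = β − (1−λγ)x₀ − p₀`, if the cubic `K³ + (α−ρ)K² − AK − B` has three
distinct real roots `K₁ < K₂ < 0 < K₃`, then
`P t = ((−αΦ + (p₀−p*)K₂)/(K₂−K₁)) e^{K₁t} + ((αΦ − (p₀−p*)K₁)/(K₂−K₁)) e^{K₂t} + p*`
is bounded on `[0,∞)`, smooth, and solves `P''' + (α−ρ)P'' − AP' − BP + αμβ(μ+ρ) = 0`
with `P 0 = p₀` and `P' 0 = αΦ`. -/
theorem stmt_13 (ρ μ α β lam γ r c x₀ p₀ K₁ K₂ K₃ : ℝ)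
    (hρ : 0 < ρ) (hμ : 0 < μ) (hα : 0 < α) (hβ : 0 < β) (hlam : 0 < lam) (hγ : 0 < γ)
    (hr : 0 < r) (hc : c ∈ Set.Ioo (0 : ℝ) 1) (hlg : 0 < 1 - lam * γ)
    (A B pstar Φ : ℝ)
    (hA : A = μ ^ 2 + ρ * μ + α * ρ)
    (hB : B = α * (μ * (μ + ρ) + (1 - lam * γ) * (1 - c) / (2 * r)))
    (hps : pstar = α * μ * β * (μ + ρ) / B)
    (hΦ : Φ = β - (1 - lam * γ) * x₀ - p₀)
    (h12 : K₁ < K₂) (h20 : K₂ < 0) (h03 : 0 < K₃)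
    (hK₁ : K₁ ^ 3 + (α - ρ) * K₁ ^ 2 - A * K₁ - B = 0)
    (hK₂ : K₂ ^ 3 + (α - ρ) * K₂ ^ 2 - A * K₂ - B = 0)
    (hK₃ : K₃ ^ 3 + (α - ρ) * K₃ ^ 2 - A * K₃ - B = 0)
    (P : ℝ → ℝ)
    (hP : ∀ t, P t =
      ((-(α * Φ) + (p₀ - pstar) * K₂) / (K₂ - K₁)) * Real.exp (K₁ * t) +
      ((α * Φ - (p₀ - pstar) * K₁) / (K₂ - K₁)) * Real.exp (K₂ * t) + pstar) :
    (∃ M : ℝ, ∀ t ≥ (0 : ℝ), |P t| ≤ M) ∧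
    ContDiff ℝ (⊤ : ℕ∞) P ∧
    (∀ t ≥ (0 : ℝ),
      iteratedDeriv 3 P t + (α - ρ) * iteratedDeriv 2 P t - A * deriv P t - B * P t +
        α * μ * β * (μ + ρ) = 0) ∧
    P 0 = p₀ ∧ deriv P 0 = α * Φ := by
  have hBpos : 0 < B := by
    have : 0 < 1 - c := sub_pos.2 hc.2
    rw [hB]
    positivity
  have hBp : B * pstar = α * μ * β * (μ + ρ) := by
    rw [hps]
    field_simp
  have hK : K₂ - K₁ ≠ 0 := (sub_pos.2 h12).ne'
  obtain rfl : P = _ := funext hP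
  refine ⟨⟨_, fun t ht => abs_exp_add_exp_add_const_le _ _ _ (h12.trans h20).le h20.le ht⟩,
    by fun_prop, fun t _ => ?_, ?_, ?_⟩
  · simp only [iteratedDeriv_succ, iteratedDeriv_zero, deriv_exp_add_exp_add_const]
    generalize (-(α * Φ) + (p₀ - pstar) * K₂) / (K₂ - K₁) = a
    generalize (α * Φ - (p₀ - pstar) * K₁) / (K₂ - K₁) = b
    linear_combination a * Real.exp (K₁ * t) * hK₁ + b * Real.exp (K₂ * t) * hK₂ - hBp
  · simp only [mul_zero, Real.exp_zero]
    field_simp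
    ring
  · simp only [deriv_exp_add_exp_add_const, mul_zero, Real.exp_zero]
    field_simp
    ring
end

section
/- Let ρ>0, μ>0, α>0, β>0, λ>0, γ>0, r>0, c ∈ (0,1) with 1−λγ > 0, and x₀, p₀ ∈ ℝ. Set A := μ² + ρμ + αρ, B := α(μ(μ+ρ) + (1−λγ)(1−c)/(2r)), p* := αμβ(μ+ρ)/B, and Φ := β − (1−λγ)x₀ − p₀. Suppose K₁ < 0 is a double real root of the cubic K³ + (α−ρ)K² − AK − B. Then the function P(t) := p* + e^{K₁t} ( p₀ − p* + (αΦ − K₁(p₀−p*)) t ) is bounded on [0,∞), infinitely differentiable, and satisfies P‴ + (α−ρ)P″ − AP′ − BP + αμβ(μ+ρ) = 0 on [0,∞) with P(0) = p₀ and P′(0) = αΦ. -/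
/-- Differentiating `q + e^{Kt}(a + bt)` keeps its shape. -/
theorem deriv_const_add_exp_mul_affine (q K a b : ℝ) :
    deriv (fun t : ℝ => q + Real.exp (K * t) * (a + b * t)) =
      fun t => 0 + Real.exp (K * t) * ((K * a + b) + K * b * t) := by
  funext t
  have hexp : HasDerivAt (fun t : ℝ => Real.exp (K * t)) (Real.exp (K * t) * (K * 1)) t :=
    ((hasDerivAt_id' t).const_mul K).exp
  have haff : HasDerivAt (fun t : ℝ => a + b * t) (b * 1) t :=
    ((hasDerivAt_id' t).const_mul b).const_add a
  have h : deriv (fun t : ℝ => q + Real.exp (K * t) * (a + b * t)) t = _ :=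
    ((hexp.mul haff).const_add q).deriv
  rw [h]
  ring

theorem abs_const_add_exp_mul_affine_le (q a b : ℝ) {K t : ℝ} (hK : K < 0) (ht : 0 ≤ t) :
    |q + Real.exp (K * t) * (a + b * t)| ≤ |q| + (|a| + |b| * (-K)⁻¹) := by
  have hexp : Real.exp (K * t) ≤ 1 :=
    Real.exp_le_one_iff.mpr (mul_nonpos_of_nonpos_of_nonneg hK.le ht)
  have htexp : Real.exp (K * t) * t ≤ (-K)⁻¹ := by
    rw [← one_div, le_div_iff₀ (neg_pos.mpr hK)]
    have h := Real.add_one_le_exp (-(K * t))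
    calc Real.exp (K * t) * t * -K = Real.exp (K * t) * -(K * t) := by ring
      _ ≤ Real.exp (K * t) * Real.exp (-(K * t)) := by gcongr; linarith
      _ = 1 := by rw [← Real.exp_add, add_neg_cancel, Real.exp_zero]
  calc |q + Real.exp (K * t) * (a + b * t)|
      ≤ |q| + Real.exp (K * t) * (|a| + |b| * t) := by
        refine (abs_add_le _ _).trans ?_
        rw [abs_mul, abs_of_pos (Real.exp_pos _)]
        gcongr
        refine (abs_add_le _ _).trans_eq ?_
        rw [abs_mul, abs_of_nonneg ht]
    _ = |q| + (Real.exp (K * t) * |a| + |b| * (Real.exp (K * t) * t)) := by ring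
    _ ≤ |q| + (|a| + |b| * (-K)⁻¹) := by
        gcongr
        exact mul_le_of_le_one_left (abs_nonneg a) hexp

/-- case Δ = 0: with `A, B, p*, Φ` as in the paper, if `K₁ < 0` is a double
real root of the cubic `K³ + (α−ρ)K² − AK − B` (i.e. it kills the cubic and its derivative),
then `P t = p* + e^{K₁t}(p₀ − p* + (αΦ − K₁(p₀−p*)) t)` is bounded on `[0,∞)`, smooth, and
solves `P''' + (α−ρ)P'' − AP' − BP + αμβ(μ+ρ) = 0` with `P 0 = p₀` and `P' 0 = αΦ`. -/
theorem stmt_14 (ρ μ α β lam γ r c x₀ p₀ K₁ : ℝ)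
    (hρ : 0 < ρ) (hμ : 0 < μ) (hα : 0 < α) (hβ : 0 < β) (hlam : 0 < lam) (hγ : 0 < γ)
    (hr : 0 < r) (hc : c ∈ Set.Ioo (0 : ℝ) 1) (hlg : 0 < 1 - lam * γ)
    (A B pstar Φ : ℝ)
    (hA : A = μ ^ 2 + ρ * μ + α * ρ)
    (hB : B = α * (μ * (μ + ρ) + (1 - lam * γ) * (1 - c) / (2 * r)))
    (hps : pstar = α * μ * β * (μ + ρ) / B)
    (hΦ : Φ = β - (1 - lam * γ) * x₀ - p₀)
    (hK₁neg : K₁ < 0)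
    (hK₁ : K₁ ^ 3 + (α - ρ) * K₁ ^ 2 - A * K₁ - B = 0)
    (hK₁' : 3 * K₁ ^ 2 + 2 * (α - ρ) * K₁ - A = 0)
    (P : ℝ → ℝ)
    (hP : ∀ t, P t = pstar +
      Real.exp (K₁ * t) * (p₀ - pstar + (α * Φ - K₁ * (p₀ - pstar)) * t)) :
    (∃ M : ℝ, ∀ t ≥ (0 : ℝ), |P t| ≤ M) ∧
    ContDiff ℝ (⊤ : ℕ∞) P ∧
    (∀ t ≥ (0 : ℝ),
      iteratedDeriv 3 P t + (α - ρ) * iteratedDeriv 2 P t - A * deriv P t - B * P t +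
        α * μ * β * (μ + ρ) = 0) ∧
    P 0 = p₀ ∧ deriv P 0 = α * Φ := by
  have hB0 : B ≠ 0 := by
    have hc' : 0 < 1 - c := sub_pos.mpr hc.2
    rw [hB]
    positivity
  have hBp : B * pstar = α * μ * β * (μ + ρ) := by
    rw [hps, mul_div_cancel₀ _ hB0]
  obtain rfl := funext hP
  refine ⟨⟨_, fun t ht => abs_const_add_exp_mul_affine_le _ _ _ hK₁neg ht⟩, by fun_prop,
    fun t _ => ?_, by simp, ?_⟩
  · simp only [iteratedDeriv_succ, iteratedDeriv_zero, deriv_const_add_exp_mul_affine]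
    linear_combination
      Real.exp (K₁ * t) * (p₀ - pstar + (α * Φ - K₁ * (p₀ - pstar)) * t) * hK₁ +
      Real.exp (K₁ * t) * (α * Φ - K₁ * (p₀ - pstar)) * hK₁' - hBp
  · rw [deriv_const_add_exp_mul_affine]
    simp
end

section
/- Let ρ>0, μ>0, α>0, β>0, λ>0, γ>0, r>0, c ∈ (0,1) with 1−λγ > 0, and x₀, p₀ ∈ ℝ. Set B := α(μ(μ+ρ) + (1−λγ)(1−c)/(2r)) and p* := αμβ(μ+ρ)/B. Suppose (P, X, U) is a triple of bounded continuously differentiable functions [0,∞) → ℝ satisfying P′ = α(β − (1−λγ)X − P) with P(0) = p₀, X′ = −μX + U with X(0) = x₀, and U′ = (μ+ρ)U − ((1−c)/(2r))P with U(0) = ((1−c)/(2r)) ∫_0^∞ e^{−(μ+ρ)t} P(t) dt. Then, as t → ∞, (P(t), X(t), U(t)) converges to (p*, (β−p*)/(1−λγ), μ(β−p*)/(1−λγ)). -/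
open MeasureTheory Set Filter

/-- A differential Grönwall inequality on `[0, ∞)`. -/
theorem le_mul_exp_of_hasDerivWithinAt_le {f f' : ℝ → ℝ} {m : ℝ}
    (hf : ∀ t ≥ (0 : ℝ), HasDerivWithinAt f (f' t) (Ici 0) t)
    (hle : ∀ t ≥ (0 : ℝ), f' t ≤ m * f t) {t : ℝ} (ht : 0 ≤ t) :
    f t ≤ f 0 * Real.exp (m * t) := by
  have hder : ∀ s ≥ (0 : ℝ), HasDerivWithinAt (fun s => f s * Real.exp (-(m * s)))
      (f' s * Real.exp (-(m * s)) + f s * (Real.exp (-(m * s)) * -(m * 1))) (Ici 0) s :=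
    fun s hs => (hf s hs).mul ((((hasDerivAt_id s).const_mul m).neg.exp).hasDerivWithinAt)
  have hanti : AntitoneOn (fun s => f s * Real.exp (-(m * s))) (Ici 0) := by
    refine antitoneOn_of_hasDerivWithinAt_nonpos (convex_Ici 0)
      (fun s hs => (hder s hs).continuousWithinAt)
      (fun s hs => (hder s (interior_subset hs)).mono interior_subset) (fun s hs => ?_)
    nlinarith [hle s (interior_subset hs), Real.exp_pos (-(m * s))]
  have h := hanti (mem_Ici.2 le_rfl) (mem_Ici.2 ht) ht
  simp only [mul_zero, neg_zero, Real.exp_zero, mul_one, Real.exp_neg] at h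
  rwa [← div_eq_mul_inv, div_le_iff₀ (Real.exp_pos _)] at h

/-- A bounded solution of `z' = s z` with `s > 0` vanishes. -/
theorem eq_zero_of_bounded_of_hasDerivWithinAt_s17 {z : ℝ → ℝ} {s M : ℝ} (hs : 0 < s)
    (hz : ∀ t ≥ (0 : ℝ), HasDerivWithinAt z (s * z t) (Ici 0) t)
    (hM : ∀ t ≥ (0 : ℝ), |z t| ≤ M) {t : ℝ} (ht : 0 ≤ t) : z t = 0 := by
  have hsq : ∀ t ≥ (0 : ℝ), HasDerivWithinAt (fun t => z t ^ 2) (2 * s * z t ^ 2) (Ici 0) t :=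
    fun t ht => ((hz t ht).pow 2).congr_deriv (by norm_num; ring)
  have hlow : ∀ t ≥ (0 : ℝ), z 0 ^ 2 * Real.exp (2 * s * t) ≤ M ^ 2 := by
    intro t ht
    have h := le_mul_exp_of_hasDerivWithinAt_le (m := 2 * s) (fun t ht => (hsq t ht).neg)
      (fun t _ => by simp) ht
    have h2 : z t ^ 2 ≤ M ^ 2 := sq_le_sq' (neg_le_of_abs_le (hM t ht)) (le_of_abs_le (hM t ht))
    simp only [Pi.neg_apply] at h
    linarith
  have hz0 : z 0 ^ 2 = 0 := by
    by_contra hne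
    have hpos : 0 < z 0 ^ 2 := lt_of_le_of_ne (sq_nonneg _) (Ne.symm hne)
    have htend : Tendsto (fun t => z 0 ^ 2 * Real.exp (2 * s * t)) atTop atTop :=
      (Real.tendsto_exp_atTop.comp
        (tendsto_id.const_mul_atTop (by positivity : 0 < 2 * s))).const_mul_atTop hpos
    obtain ⟨t, ht, ht0⟩ := ((htend.eventually_gt_atTop (M ^ 2)).and (eventually_ge_atTop 0)).exists
    exact absurd (hlow t ht0) (not_le.2 ht)
  have h := le_mul_exp_of_hasDerivWithinAt_le hsq (fun _ _ => le_rfl) ht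
  simp only [hz0, zero_mul] at h
  exact pow_eq_zero_iff two_ne_zero |>.1 (le_antisymm h (sq_nonneg _))

/-- Nonnegative solutions of `V' ≤ -m V` with `m > 0` tend to zero. -/
theorem tendsto_zero_of_hasDerivWithinAt_le {V V' : ℝ → ℝ} {m : ℝ} (hm : 0 < m)
    (hV : ∀ t ≥ (0 : ℝ), HasDerivWithinAt V (V' t) (Ici 0) t) (hnn : ∀ t, 0 ≤ V t)
    (hle : ∀ t ≥ (0 : ℝ), V' t ≤ -m * V t) : Tendsto V atTop (nhds 0) := by
  have htend : Tendsto (fun t => V 0 * Real.exp (-m * t)) atTop (nhds 0) := by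
    simpa using (Real.tendsto_exp_atBot.comp
      (tendsto_id.const_mul_atTop_of_neg (neg_lt_zero.2 hm))).const_mul (V 0)
  exact tendsto_of_tendsto_of_tendsto_of_le_of_le' tendsto_const_nhds htend
    (Eventually.of_forall hnn) ((eventually_ge_atTop 0).mono fun t ht =>
      le_mul_exp_of_hasDerivWithinAt_le hV hle ht)

theorem tendsto_zero_of_mul_sq_le {f V : ℝ → ℝ} {a : ℝ} (ha : 0 < a)
    (hle : ∀ t, a * f t ^ 2 ≤ V t) (hV : Tendsto V atTop (nhds 0)) :
    Tendsto f atTop (nhds 0) := by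
  have hsq : Tendsto (fun t => f t ^ 2) atTop (nhds 0) := by
    refine squeeze_zero (fun t => sq_nonneg _) (fun t => ?_) (by simpa using hV.div_const a)
    rw [le_div_iff₀ ha]
    linarith [hle t]
  refine (tendsto_zero_iff_abs_tendsto_zero f).2 ?_
  simpa [Function.comp_def, Real.sqrt_sq_eq_abs] using
    (Real.continuous_sqrt.tendsto 0).comp hsq

/-- The unstable eigenvalue of the system. -/
theorem exists_gt_root {α μ ν κ : ℝ} (hα : 0 < α) (hμ : 0 < μ) (hν : 0 < ν) (hκ : 0 < κ) :
    ∃ s > ν, (s + α) * (s + μ) * (s - ν) = κ := by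
  have hT : 0 < κ / (α * μ) := by positivity
  have hcont : ContinuousOn (fun s => (s + α) * (s + μ) * (s - ν))
      (Icc ν (ν + κ / (α * μ))) := by fun_prop
  obtain ⟨s, ⟨hs, -⟩, hsκ⟩ := intermediate_value_Icc (by linarith) hcont
    (show κ ∈ Icc _ _ by
      refine ⟨by simpa using hκ.le, ?_⟩
      have h : α * μ * (κ / (α * μ)) = κ := by field_simp
      simp only [add_sub_cancel_left]
      calc κ = α * μ * (κ / (α * μ)) := h.symm
        _ ≤ _ := by gcongr <;> linarith)
  refine ⟨s, lt_of_le_of_ne hs ?_, hsκ⟩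
  rintro rfl
  simp at hsκ
  exact hκ.ne hsκ

/-- Bounded solutions of the homogeneous linear system tend to the origin. -/
theorem tendsto_zero_of_bounded_linear_system {α μ ν k d Mp Mx Mu : ℝ}
    (hα : 0 < α) (hμ : 0 < μ) (hν : 0 < ν) (hk : 0 < k) (hd : 0 < d) {p x u : ℝ → ℝ}
    (hMp : ∀ t ≥ (0 : ℝ), |p t| ≤ Mp) (hMx : ∀ t ≥ (0 : ℝ), |x t| ≤ Mx)
    (hMu : ∀ t ≥ (0 : ℝ), |u t| ≤ Mu)
    (hp : ∀ t ≥ (0 : ℝ), HasDerivWithinAt p (-α * p t - α * k * x t) (Ici 0) t)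
    (hx : ∀ t ≥ (0 : ℝ), HasDerivWithinAt x (-μ * x t + u t) (Ici 0) t)
    (hu : ∀ t ≥ (0 : ℝ), HasDerivWithinAt u (ν * u t - d * p t) (Ici 0) t) :
    Tendsto p atTop (nhds 0) ∧ Tendsto x atTop (nhds 0) ∧ Tendsto u atTop (nhds 0) := by
  obtain ⟨s, hsν, hroot⟩ := exists_gt_root hα hμ hν (show 0 < α * k * d by positivity)
  have hs : 0 < s := hν.trans hsν
  obtain ⟨e, he, hed⟩ : ∃ e > 0, e * (s + α) = d :=
    ⟨d / (s + α), by positivity, by field_simp⟩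
  have hek : (s + μ) * (s - ν) = α * k * e := by
    have h : (s + α) ≠ 0 := by positivity
    apply mul_left_cancel₀ h
    linear_combination hroot - α * k * hed
  have hzder : ∀ t ≥ (0 : ℝ), HasDerivWithinAt (fun t => u t + (s - ν) * x t - e * p t)
      (s * (u t + (s - ν) * x t - e * p t)) (Ici 0) t := by
    intro t ht
    refine (((hu t ht).add ((hx t ht).const_mul (s - ν))).sub
      ((hp t ht).const_mul e)).congr_deriv ?_
    linear_combination -x t * hek + p t * hed
  have hzbd : ∀ t ≥ (0 : ℝ), |u t + (s - ν) * x t - e * p t| ≤ Mu + (s - ν) * Mx + e * Mp := by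
    intro t ht
    have h1 := abs_le.1 (hMu t ht)
    have h2 := abs_le.1 (hMx t ht)
    have h3 := abs_le.1 (hMp t ht)
    have hsν' : 0 < s - ν := sub_pos.2 hsν
    rw [abs_le]
    constructor <;> nlinarith
  have hz : ∀ t ≥ (0 : ℝ), u t + (s - ν) * x t - e * p t = 0 := fun t ht =>
    eq_zero_of_bounded_of_hasDerivWithinAt_s17 hs hzder hzbd ht
  have hak : 0 < α * k := mul_pos hα hk
  have hV : Tendsto (fun t => α * k * x t ^ 2 + e * p t ^ 2) atTop (nhds 0) := by
    refine tendsto_zero_of_hasDerivWithinAt_le (m := 2 * min μ α)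
      (by have := lt_min hμ hα; linarith)
      (fun t ht => (((hx t ht).pow 2).const_mul (α * k)).add (((hp t ht).pow 2).const_mul e))
      (fun t => by positivity) (fun t ht => ?_)
    have hut : u t = e * p t - (s - ν) * x t := by linarith [hz t ht]
    rw [hut]
    have h1 : 0 ≤ (μ + (s - ν) - min μ α) * (α * k * x t ^ 2) :=
      mul_nonneg (by linarith [min_le_left μ α]) (by positivity)
    have h2 : 0 ≤ (α - min μ α) * (e * p t ^ 2) :=
      mul_nonneg (by linarith [min_le_right μ α]) (by positivity)
    norm_num
    linarith
  have hx0 : Tendsto x atTop (nhds 0) :=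
    tendsto_zero_of_mul_sq_le hak (fun t => le_add_of_nonneg_right (by positivity)) hV
  have hp0 : Tendsto p atTop (nhds 0) :=
    tendsto_zero_of_mul_sq_le he (fun t => le_add_of_nonneg_left (by positivity)) hV
  refine ⟨hp0, hx0, ?_⟩
  have hlim : Tendsto (fun t => e * p t - (s - ν) * x t) atTop (nhds 0) := by
    simpa using (hp0.const_mul e).sub (hx0.const_mul (s - ν))
  refine hlim.congr' ((eventually_ge_atTop 0).mono fun t ht => ?_)
  linarith [hz t ht]

/-- Any bounded C¹ solution triple `(P, X, U)` of the coupled system (with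
initial conditions `P 0 = p₀`, `X 0 = x₀` and
`U 0 = ((1−c)/(2r)) ∫_0^∞ e^{−(μ+ρ)t} P(t) dt`) converges, as `t → ∞`, to the stationary
point `(p*, (β−p*)/(1−λγ), μ(β−p*)/(1−λγ))`, where `p* = αμβ(μ+ρ)/B` and
`B = α(μ(μ+ρ) + (1−λγ)(1−c)/(2r))`. -/
theorem stmt_17 (ρ μ α β lam γ r c x₀ p₀ : ℝ)
    (hρ : 0 < ρ) (hμ : 0 < μ) (hα : 0 < α) (hβ : 0 < β) (hlam : 0 < lam) (hγ : 0 < γ)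
    (hr : 0 < r) (hc : c ∈ Ioo (0 : ℝ) 1) (hlg : 0 < 1 - lam * γ)
    (B pstar : ℝ)
    (hB : B = α * (μ * (μ + ρ) + (1 - lam * γ) * (1 - c) / (2 * r)))
    (hps : pstar = α * μ * β * (μ + ρ) / B)
    (P X U : ℝ → ℝ)
    (hbdP : ∃ M : ℝ, ∀ t ≥ (0 : ℝ), |P t| ≤ M)
    (hbdX : ∃ M : ℝ, ∀ t ≥ (0 : ℝ), |X t| ≤ M)
    (hbdU : ∃ M : ℝ, ∀ t ≥ (0 : ℝ), |U t| ≤ M)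
    (hPC1 : ContDiffOn ℝ 1 P (Ici 0)) (hXC1 : ContDiffOn ℝ 1 X (Ici 0))
    (hUC1 : ContDiffOn ℝ 1 U (Ici 0))
    (hPode : ∀ t ≥ (0 : ℝ),
      HasDerivWithinAt P (α * (β - (1 - lam * γ) * X t - P t)) (Ici 0) t)
    (hXode : ∀ t ≥ (0 : ℝ), HasDerivWithinAt X (-μ * X t + U t) (Ici 0) t)
    (hUode : ∀ t ≥ (0 : ℝ),
      HasDerivWithinAt U ((μ + ρ) * U t - ((1 - c) / (2 * r)) * P t) (Ici 0) t)
    (hP0 : P 0 = p₀) (hX0 : X 0 = x₀)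
    (hU0 : U 0 = ((1 - c) / (2 * r)) * ∫ t in Ioi (0 : ℝ), Real.exp (-(μ + ρ) * t) * P t) :
    Tendsto (fun t => (P t, X t, U t)) atTop
      (nhds (pstar, (β - pstar) / (1 - lam * γ), μ * (β - pstar) / (1 - lam * γ))) := by
  obtain ⟨MP, hMP⟩ := hbdP
  obtain ⟨MX, hMX⟩ := hbdX
  obtain ⟨MU, hMU⟩ := hbdU
  have hd : 0 < (1 - c) / (2 * r) := div_pos (sub_pos.2 hc.2) (by positivity)
  have hdiv : (1 - lam * γ) * (1 - c) / (2 * r) = (1 - lam * γ) * ((1 - c) / (2 * r)) :=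
    mul_div_assoc _ _ _
  rw [hdiv] at hB
  generalize (1 - c) / (2 * r) = d at *
  generalize 1 - lam * γ = k at *
  have hBpos : 0 < B := by rw [hB]; positivity
  have hpB : pstar * (μ * (μ + ρ) + k * d) = μ * β * (μ + ρ) := by
    apply mul_left_cancel₀ hα.ne'
    have h : pstar * B = α * μ * β * (μ + ρ) := by rw [hps]; field_simp
    rw [hB] at h
    linear_combination h
  have hXs : k * ((β - pstar) / k) = β - pstar := by field_simp
  have hUs : μ * (β - pstar) / k = μ * ((β - pstar) / k) := mul_div_assoc _ _ _
  rw [hUs]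
  generalize (β - pstar) / k = xs at *
  have hstat : (μ + ρ) * (μ * xs) = d * pstar := by
    apply mul_left_cancel₀ hlg.ne'
    linear_combination (μ + ρ) * μ * hXs - hpB
  have hshift : ∀ {f : ℝ → ℝ} {M : ℝ} (a : ℝ), (∀ t ≥ (0 : ℝ), |f t| ≤ M) →
      ∀ t ≥ (0 : ℝ), |f t - a| ≤ M + |a| := fun a hf t ht =>
    (abs_sub _ _).trans (add_le_add_left (hf t ht) _)
  obtain ⟨hp, hx, hu⟩ := tendsto_zero_of_bounded_linear_system hα hμ (add_pos hμ hρ) hlg hd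
    (hshift pstar hMP) (hshift xs hMX) (hshift (μ * xs) hMU)
    (fun t ht => ((hPode t ht).sub_const pstar).congr_deriv (by linear_combination -α * hXs))
    (fun t ht => ((hXode t ht).sub_const xs).congr_deriv (by ring))
    (fun t ht => ((hUode t ht).sub_const (μ * xs)).congr_deriv (by linear_combination hstat))
  exact (tendsto_sub_nhds_zero_iff.1 hp).prodMk_nhds
    ((tendsto_sub_nhds_zero_iff.1 hx).prodMk_nhds (tendsto_sub_nhds_zero_iff.1 hu))
end
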